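/- Fix a positive integer s and a real ε > 0. There exist δ > 0 and C > 0, depending only on s and ε, with the following property. Let p be a prime, and let H and M be integers satisfying H^{24/17}·M^{11/17} > p^{1+ε}, H^{9/5}·M^{2/5} > p^{1+ε}, and H^{6/5}·M > p^{1+ε}. Let 𝓜_1, …, 𝓜_6 ⊆ 𝔽_p^* be sets each of cardinality M, and let L_1, …, L_6 be integers such that {L_i+1, …, L_i+H} ⊆ {1, …, p−1} for each i. For any integer λ, let T_6(λ) denote the number of solutions of the congruence m_1·x_1^{−s} + m_2·x_2^{−s} + m_3·x_3^{−s} + m_4·x_4^{−s} + m_5·x_5^{−s} + m_6·x_6^{−s} ≡ λ (mod p) with m_i ∈ 𝓜_i and x_i ∈ {L_i+1, …, L_i+H} for i = 1, …, 6. Then |T_6(λ) − H^6·M^6/p| ≤ C · (H^6·M^6/p) · p^{−δ}. -/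

import Mathlib

open Finset

theorem divisor_bound (η : ℝ) (hη : 0 < η) :
    ∃ C : ℝ, 1 ≤ C ∧ ∀ n : ℕ, n ≠ 0 → ((n.divisors.card : ℕ) : ℝ) ≤ C * (n : ℝ) ^ η := by
  set C0 : ℝ := 1 + 1 / (η * Real.log 2) with hC0
  have hlog : 0 < Real.log 2 := Real.log_pos (by norm_num)
  have hC01 : 1 ≤ C0 := by
    have : 0 < 1 / (η * Real.log 2) := by positivity
    linarith
  obtain ⟨B, hB⟩ := exists_nat_ge ((2:ℝ) ^ (1 / η))
  refine ⟨C0 ^ B, one_le_pow₀ hC01, ?_⟩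
  intro n hn
  have h1 : ∀ q ∈ n.primeFactors, (((n.factorization q + 1 : ℕ)) : ℝ) ≤
      (if q < B then C0 else 1) * (((q : ℝ) ^ (n.factorization q)) ^ η) := by
    intro q hq
    have hq2 : 2 ≤ q := (Nat.prime_of_mem_primeFactors hq).two_le
    set e := n.factorization q
    have hqr : (2:ℝ) ≤ q := by exact_mod_cast hq2
    have hq0 : (0:ℝ) ≤ q := by linarith
    rw [← Real.rpow_natCast, ← Real.rpow_mul hq0]
    split_ifs with hqB
    · have h2 : (2:ℝ) ^ ((e:ℝ) * η) ≤ (q:ℝ) ^ ((e:ℝ) * η) :=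
        Real.rpow_le_rpow (by norm_num) hqr (by positivity)
      have h3 : 1 + (e:ℝ) * η * Real.log 2 ≤ (2:ℝ) ^ ((e:ℝ) * η) := by
        rw [Real.rpow_def_of_pos (by norm_num)]
        have := Real.add_one_le_exp (Real.log 2 * (e * η))
        linarith
      have h4 : ((e + 1 : ℕ) : ℝ) ≤ C0 * (1 + (e:ℝ) * η * Real.log 2) := by
        have : C0 * (1 + (e:ℝ) * η * Real.log 2) = 1 + e + (e:ℝ) * η * Real.log 2 + 1 / (η * Real.log 2) := by
          rw [hC0]; field_simp; ring
        rw [this]; push_cast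
        have : 0 ≤ (e:ℝ) * η * Real.log 2 + 1 / (η * Real.log 2) := by positivity
        linarith
      refine h4.trans ?_
      gcongr
      linarith
    · push Not at hqB
      rw [one_mul]
      have h2 : (2:ℝ) ^ (1/η) ≤ q := hB.trans (by exact_mod_cast hqB)
      have h3 : ((2:ℝ) ^ (1/η)) ^ ((e:ℝ) * η) ≤ (q:ℝ) ^ ((e:ℝ) * η) :=
        Real.rpow_le_rpow (by positivity) h2 (by positivity)
      rw [← Real.rpow_mul (by norm_num)] at h3
      have h4 : 1 / η * ((e:ℝ) * η) = e := by field_simp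
      rw [h4, Real.rpow_natCast] at h3
      refine le_trans ?_ h3
      exact_mod_cast Nat.lt_two_pow_self (n := e)
  rw [Nat.card_divisors hn]
  push_cast
  have h2 : (n : ℝ) ^ η = ∏ q ∈ n.primeFactors, (((q : ℝ) ^ (n.factorization q)) ^ η) := by
    rw [Real.finsetProd_rpow]
    · congr 1
      conv_lhs => rw [← Nat.prod_factorization_pow_eq_self hn]
      rw [Finsupp.prod]; push_cast; rfl
    · intro i _; positivity
  calc ∏ x ∈ n.primeFactors, ((n.factorization x : ℝ) + 1)
      ≤ ∏ q ∈ n.primeFactors, ((if q < B then C0 else 1) * (((q : ℝ) ^ (n.factorization q)) ^ η)) := by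
        apply Finset.prod_le_prod
        · intro i _; positivity
        · intro i hi; have := h1 i hi; push_cast at this; exact this
    _ = (∏ q ∈ n.primeFactors, (if q < B then C0 else 1)) * (n:ℝ) ^ η := by
        rw [Finset.prod_mul_distrib, h2]
    _ ≤ C0 ^ B * (n:ℝ) ^ η := by
        gcongr
        rw [Finset.prod_ite, Finset.prod_const, Finset.prod_const_one, mul_one]
        apply pow_le_pow_right₀ hC01
        calc _ ≤ (Finset.range B).card := by
              apply Finset.card_le_card
              intro q hq
              simp at hq ⊢
              exact hq.2
          _ = B := by simp

/-- factor pairs of a nonzero integer in a symmetric box -/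
theorem factor_pairs (X : ℕ) (n : ℤ) (hn : n ≠ 0) :
    ((Icc (-(X:ℤ)) X ×ˢ Icc (-(X:ℤ)) X).filter (fun t => t.1 * t.2 = n)).card
      ≤ 2 * n.natAbs.divisors.card := by
  have : ((Icc (-(X:ℤ)) X ×ˢ Icc (-(X:ℤ)) X).filter (fun t => t.1 * t.2 = n)).card
      ≤ ((Finset.univ : Finset Bool) ×ˢ n.natAbs.divisors).card := by
    apply Finset.card_le_card_of_injOn (fun t => (decide (0 ≤ t.1), t.1.natAbs))
    · intro t ht
      simp at ht ⊢
      refine ⟨le_or_gt _ _, ?_, hn⟩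
      rw [← ht.2]; exact dvd_mul_right _ _
    · intro t ht t' ht' h
      simp only [coe_filter, mem_product, Set.mem_ofPred_eq] at ht ht'
      simp only [Prod.mk.injEq, decide_eq_decide] at h
      have h1 : t.1 = t'.1 := by omega
      have h2 : t.1 ≠ 0 := by
        rintro h0; rw [h0] at ht; simp at ht; exact hn ht.2.symm
      have h3 : t.2 = t'.2 := by
        have := ht.2.trans ht'.2.symm
        rw [← h1] at this
        exact mul_left_cancel₀ h2 this
      exact Prod.ext h1 h3
  simpa using this

/-- hypothesis form: `D` bounds the number of factor pairs -/
def DivB (p : ℕ) (D : ℝ) : Prop :=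
  1 ≤ D ∧ ∀ X : ℕ, X < p → ∀ n : ℤ, n ≠ 0 →
    (((Icc (-(X:ℤ)) X ×ˢ Icc (-(X:ℤ)) X).filter (fun t => t.1 * t.2 = n)).card : ℝ) ≤ D

theorem exists_DivB (η : ℝ) (hη : 0 < η) :
    ∃ C : ℝ, 1 ≤ C ∧ ∀ p : ℕ, 1 ≤ p → DivB p (C * (p:ℝ) ^ η) := by
  obtain ⟨C, hC, h⟩ := divisor_bound (η / 2) (by positivity)
  refine ⟨2 * C, by linarith, ?_⟩
  intro p hp
  have hp1 : (1:ℝ) ≤ p := by exact_mod_cast hp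
  have hpe : 1 ≤ (p:ℝ) ^ η := Real.one_le_rpow hp1 hη.le
  refine ⟨by nlinarith, ?_⟩
  intro X hX n hn
  by_cases hne : ((Icc (-(X:ℤ)) X ×ˢ Icc (-(X:ℤ)) X).filter (fun t => t.1 * t.2 = n)).card = 0
  · rw [hne]; push_cast; positivity
  have h1 := factor_pairs X n hn
  obtain ⟨t, ht⟩ := Finset.card_pos.mp (Nat.pos_of_ne_zero hne)
  simp only [mem_filter, mem_product, mem_Icc] at ht
  have h2 : n.natAbs ≤ p ^ 2 := by
    rw [← ht.2, Int.natAbs_mul, sq]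
    apply Nat.mul_le_mul <;> omega
  have h3 := h n.natAbs (by omega)
  calc (_ : ℝ) ≤ ((2 * n.natAbs.divisors.card : ℕ) : ℝ) := by exact_mod_cast h1
    _ = 2 * (n.natAbs.divisors.card : ℝ) := by push_cast; ring
    _ ≤ 2 * (C * (n.natAbs : ℝ) ^ (η/2)) := by gcongr
    _ ≤ 2 * (C * (((p:ℝ)^2) ^ (η/2))) := by
      gcongr; exact_mod_cast h2
    _ = 2 * C * (p:ℝ) ^ η := by
      rw [← Real.rpow_natCast, ← Real.rpow_mul (by positivity)]
      push_cast
      rw [show (2:ℝ) * (η/2) = η by ring]; ring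


theorem thue (p : ℕ) [Fact p.Prime] (ρ : ZMod p) :
    ∃ q : ℕ, 1 ≤ q ∧ q ^ 2 ≤ p ∧ ∃ a b : ℤ, (a : ZMod p) = ρ * b ∧ max a.natAbs b.natAbs = q := by
  set r := Nat.sqrt p with hr
  have hcard : (Finset.univ : Finset (ZMod p)).card < (range (r+1) ×ˢ range (r+1)).card := by
    rw [card_product, card_range, Finset.card_univ, ZMod.card]
    exact Nat.lt_succ_sqrt p
  obtain ⟨x, hx, y, hy, hxy, h⟩ := Finset.exists_ne_map_eq_of_card_lt_of_maps_to hcard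
    (f := fun t : ℕ × ℕ => (t.1 : ZMod p) - ρ * t.2) (by intro t _; simp)
  simp only [mem_product, mem_range] at hx hy
  refine ⟨max ((x.1:ℤ) - y.1).natAbs ((x.2:ℤ) - y.2).natAbs, ?_, ?_, (x.1:ℤ) - y.1, (x.2:ℤ) - y.2, ?_, rfl⟩
  · by_contra hlt
    apply hxy
    have : max ((x.1:ℤ) - y.1).natAbs ((x.2:ℤ) - y.2).natAbs = 0 := by omega
    apply Prod.ext <;> omega
  · calc _ ≤ r ^ 2 := by
          apply Nat.pow_le_pow_left; omega
      _ ≤ p := Nat.sqrt_le' p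
  · push_cast
    have : (x.1 : ZMod p) - ρ * x.2 = y.1 - ρ * y.2 := h
    linear_combination this

theorem shortest (p : ℕ) [Fact p.Prime] (ρ : ZMod p) :
    ∃ q : ℕ, 1 ≤ q ∧ q ^ 2 ≤ p ∧ (∃ a b : ℤ, (a : ZMod p) = ρ * b ∧ max a.natAbs b.natAbs = q) ∧
      ∀ c d : ℤ, (c : ZMod p) = ρ * d → (c ≠ 0 ∨ d ≠ 0) → q ≤ max c.natAbs d.natAbs := by
  classical
  have hex : ∃ q : ℕ, 1 ≤ q ∧ ∃ a b : ℤ, (a : ZMod p) = ρ * b ∧ max a.natAbs b.natAbs = q := by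
    obtain ⟨q, h1, _, h⟩ := thue p ρ
    exact ⟨q, h1, h⟩
  obtain ⟨h1, h2⟩ := Nat.find_spec hex
  refine ⟨Nat.find hex, h1, ?_, h2, ?_⟩
  · obtain ⟨q, h1, hq, h⟩ := thue p ρ
    have := Nat.find_min' hex ⟨h1, h⟩
    exact (Nat.pow_le_pow_left this 2).trans hq
  · intro c d hcd hne
    apply Nat.find_min' hex
    refine ⟨?_, c, d, hcd, rfl⟩
    omega

/-- number of lattice points -/
def NN (p : ℕ) (ρ : ZMod p) (I J : Finset ℤ) : ℕ :=
  ((I ×ˢ J).filter (fun t => (t.1 : ZMod p) = ρ * t.2)).card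

theorem lattice_nat (p : ℕ) [hp : Fact p.Prime] (ρ : ZMod p) (q : ℕ) (hq : 1 ≤ q) (a b : ℤ)
    (hab : (a : ZMod p) = ρ * b) (hmax : max a.natAbs b.natAbs = q)
    (hmin : ∀ c d : ℤ, (c : ZMod p) = ρ * d → (c ≠ 0 ∨ d ≠ 0) → q ≤ max c.natAbs d.natAbs)
    (L₁ L₂ : ℤ) (H : ℕ) :
    NN p ρ (Ico L₁ (L₁ + H)) (Ico L₂ (L₂ + H)) ≤ (4 * q * H / p + 2) * (H / q + 1) := by
  have hp0 : (0:ℤ) < p := by exact_mod_cast hp.out.pos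
  set Df : ℤ × ℤ → ℤ := fun t => a * (t.2 - L₂) - b * (t.1 - L₁) with hDf
  set cf : ℤ × ℤ → ℤ := fun t => if b.natAbs ≤ a.natAbs then t.1 - L₁ else t.2 - L₂ with hcf
  have hmap : NN p ρ (Ico L₁ (L₁ + H)) (Ico L₂ (L₂ + H)) ≤
      (Icc ((-(2*q*H:ℤ)) / p) ((2*q*H:ℤ)/p) ×ˢ Icc (0:ℤ) (H / q : ℕ)).card := by
    unfold NN
    apply Finset.card_le_card_of_injOn (fun t => (Df t / p, cf t / q))
    · intro t ht
      simp only [coe_filter, mem_product, mem_Ico, Set.mem_ofPred_eq] at ht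
      simp only [coe_product, coe_Icc, Set.mem_prod, Set.mem_Icc]
      obtain ⟨⟨⟨h1, h2⟩, h3, h4⟩, -⟩ := ht
      have ha : |a| ≤ q := by rw [Int.abs_eq_natAbs]; omega
      have hb : |b| ≤ q := by rw [Int.abs_eq_natAbs]; omega
      have e1 : |a * (t.2 - L₂)| ≤ q * H := by
        rw [abs_mul]
        apply mul_le_mul ha _ (abs_nonneg _) (by positivity)
        rw [abs_le]; constructor <;> linarith
      have e2 : |b * (t.1 - L₁)| ≤ q * H := by
        rw [abs_mul]
        apply mul_le_mul hb _ (abs_nonneg _) (by positivity)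
        rw [abs_le]; constructor <;> linarith
      rw [abs_le] at e1 e2
      refine ⟨⟨Int.ediv_le_ediv hp0 ?_, Int.ediv_le_ediv hp0 ?_⟩, ?_, ?_⟩
      · simp only [hDf]; linarith
      · simp only [hDf]; linarith
      · apply Int.ediv_nonneg _ (by positivity)
        simp only [hcf]; split_ifs <;> linarith
      · push_cast
        apply Int.ediv_le_ediv (by exact_mod_cast hq)
        simp only [hcf]; split_ifs <;> linarith
    · intro t ht t' ht' h
      simp only [coe_filter, mem_product, mem_Ico, Set.mem_ofPred_eq] at ht ht'
      simp only [Prod.mk.injEq] at h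
      obtain ⟨hD, hc⟩ := h
      obtain ⟨-, ht⟩ := ht
      obtain ⟨-, ht'⟩ := ht'
      have hcd : ((t.1 - t'.1 : ℤ) : ZMod p) = ρ * ((t.2 - t'.2 : ℤ)) := by
        push_cast; linear_combination ht - ht'
      have hmod : ((Df t - Df t' : ℤ) : ZMod p) = 0 := by
        simp only [hDf]
        push_cast
        rw [ht, ht', hab]; ring
      rw [ZMod.intCast_zmod_eq_zero_iff_dvd] at hmod
      have hDeq : Df t = Df t' := by
        obtain ⟨k, hk⟩ := hmod
        have e1 := Int.emod_add_mul_ediv (Df t) p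
        have e2 := Int.emod_add_mul_ediv (Df t') p
        have e3 := Int.emod_nonneg (Df t) hp0.ne'
        have e4 := Int.emod_lt_of_pos (Df t) hp0
        have e5 := Int.emod_nonneg (Df t') hp0.ne'
        have e6 := Int.emod_lt_of_pos (Df t') hp0
        rw [hD] at e1
        have e7 : (p:ℤ) * k < p * 1 := by linarith
        have e8 : (p:ℤ) * (-1) < p * k := by linarith
        have := lt_of_mul_lt_mul_left e7 hp0.le
        have := lt_of_mul_lt_mul_left e8 hp0.le
        have : k = 0 := by omega
        rw [this] at hk; linarith
      have hlin : a * (t.2 - t'.2) = b * (t.1 - t'.1) := by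
        simp only [hDf] at hDeq; linear_combination hDeq
      have hlin' : a.natAbs * (t.2 - t'.2).natAbs = b.natAbs * (t.1 - t'.1).natAbs := by
        rw [← Int.natAbs_mul, ← Int.natAbs_mul, hlin]
      have hcdiff : (cf t - cf t').natAbs < q := by
        have hq0 : (0:ℤ) < q := by exact_mod_cast hq
        have e1 := Int.emod_add_mul_ediv (cf t) q
        have e2 := Int.emod_add_mul_ediv (cf t') q
        have e3 := Int.emod_nonneg (cf t) hq0.ne'
        have e4 := Int.emod_lt_of_pos (cf t) hq0
        have e5 := Int.emod_nonneg (cf t') hq0.ne'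
        have e6 := Int.emod_lt_of_pos (cf t') hq0
        rw [hc] at e1
        have : cf t - cf t' < q := by linarith
        have : -(q:ℤ) < cf t - cf t' := by linarith
        omega
      by_contra hne
      have hne' : (t.1 - t'.1 ≠ 0 ∨ t.2 - t'.2 ≠ 0) := by
        by_contra hcon
        push Not at hcon
        exact hne (Prod.ext (by linarith [hcon.1]) (by linarith [hcon.2]))
      have hm := hmin _ _ hcd hne'
      by_cases hba : b.natAbs ≤ a.natAbs
      · have hs : cf t - cf t' = t.1 - t'.1 := by simp only [hcf, if_pos hba]; ring
        rw [hs] at hcdiff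
        have ha0 : 0 < a.natAbs := by omega
        have : (t.2 - t'.2).natAbs ≤ (t.1 - t'.1).natAbs := by
          by_contra hlt
          push Not at hlt
          have : b.natAbs * (t.1 - t'.1).natAbs ≤ a.natAbs * (t.1 - t'.1).natAbs :=
            Nat.mul_le_mul_right _ hba
          have : a.natAbs * (t.1 - t'.1).natAbs < a.natAbs * (t.2 - t'.2).natAbs :=
            Nat.mul_lt_mul_of_pos_left hlt ha0
          omega
        omega
      · have hs : cf t - cf t' = t.2 - t'.2 := by simp only [hcf, if_neg hba]; ring
        rw [hs] at hcdiff
        have hb0 : 0 < b.natAbs := by omega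
        have : (t.1 - t'.1).natAbs ≤ (t.2 - t'.2).natAbs := by
          by_contra hlt
          push Not at hlt
          have : a.natAbs * (t.2 - t'.2).natAbs ≤ b.natAbs * (t.2 - t'.2).natAbs :=
            Nat.mul_le_mul_right _ (by omega)
          have : b.natAbs * (t.2 - t'.2).natAbs < b.natAbs * (t.1 - t'.1).natAbs :=
            Nat.mul_lt_mul_of_pos_left hlt hb0
          omega
        omega
  refine hmap.trans ?_
  rw [card_product, Int.card_Icc, Int.card_Icc]
  apply Nat.mul_le_mul
  · have hp1 : 0 < p := hp.out.pos
    have key : (2*q*H:ℤ)/p - (-(2*q*H:ℤ)) / p ≤ (4 * q * H / p : ℕ) + 1 := by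
      push_cast
      set y : ℤ := 2*q*H with hy
      have hy4 : (4 * q * H : ℤ) = 2 * y := by rw [hy]; ring
      rw [hy4]
      have e1 := Int.emod_add_mul_ediv y p
      have e2 := Int.emod_add_mul_ediv (-y) p
      have e0 := Int.emod_add_mul_ediv (2*y) p
      have e3 := Int.emod_nonneg y hp0.ne'
      have e4 := Int.emod_lt_of_pos y hp0
      have e5 := Int.emod_nonneg (-y) hp0.ne'
      have e6 := Int.emod_lt_of_pos (-y) hp0
      have e7 := Int.emod_nonneg (2*y) hp0.ne'
      have e8 := Int.emod_lt_of_pos (2*y) hp0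
      have : (p:ℤ) * (y / p - (-y)/p) < p * (2 * y / p + 2) := by linarith
      have := lt_of_mul_lt_mul_left this hp0.le
      linarith
    generalize 4 * q * H / p = z at key ⊢
    omega
  · generalize H / q = z
    omega

/-- real form -/
theorem lattice_real (p : ℕ) [hp : Fact p.Prime] (ρ : ZMod p) (hρ : ρ ≠ 0) (X : ℕ) (hX : 1 ≤ X)
    (hXp : X < p) (L₁ L₂ : ℤ) (H : ℕ) :
    (NN p ρ (Ico L₁ (L₁ + H)) (Ico L₂ (L₂ + H)) : ℝ) ≤
      6 * (1 + (H:ℝ)^2 / p + (H:ℝ) / X * (1 +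
        ((Icc (-(X:ℤ)) X ×ˢ Icc (-(X:ℤ)) X).filter
          (fun t => (t.1 : ZMod p) ≠ 0 ∧ (t.2 : ZMod p) ≠ 0 ∧ (t.1 : ZMod p) = ρ * t.2)).card)) := by
  obtain ⟨q, hq, hqp, ⟨a, b, hab, hmax⟩, hmin⟩ := shortest p ρ
  have h := lattice_nat p ρ q hq a b hab hmax hmin L₁ L₂ H
  set Z := ((Icc (-(X:ℤ)) X ×ˢ Icc (-(X:ℤ)) X).filter
          (fun t => (t.1 : ZMod p) ≠ 0 ∧ (t.2 : ZMod p) ≠ 0 ∧ (t.1 : ZMod p) = ρ * t.2)).card with hZ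
  have hp1 : 1 < p := hp.out.one_lt
  have hqltp : q < p := by nlinarith
  have hsmall : ∀ c : ℤ, c.natAbs < p → (c : ZMod p) = 0 → c = 0 := by
    intro c hc h0
    rw [ZMod.intCast_zmod_eq_zero_iff_dvd] at h0
    exact Int.eq_zero_of_abs_lt_dvd h0 (by rw [Int.abs_eq_natAbs]; omega)
  have hb0 : b ≠ 0 := by
    intro hb
    rw [hb] at hab; simp at hab
    have := hsmall a (by omega) hab
    subst this; subst hb; simp at hmax; omega
  have ha0 : a ≠ 0 := by
    intro ha
    rw [ha] at hab; simp [hρ] at hab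
    exact hb0 (hsmall b (by omega) hab)
  have hZX : X / q ≤ Z := by
    rw [hZ]
    calc X / q = (Icc 1 (X / q)).card := by simp
      _ ≤ _ := ?_
    apply Finset.card_le_card_of_injOn (fun k : ℕ => ((k:ℤ) * a, (k:ℤ) * b))
    · intro k hk
      simp only [coe_Icc, Set.mem_Icc] at hk
      have hkq : k * q ≤ X := (Nat.mul_le_mul_right q hk.2).trans (Nat.div_mul_le_self X q)
      have h1 : ((k:ℤ) * a).natAbs ≤ X := by
        rw [Int.natAbs_mul, Int.natAbs_natCast]
        exact (Nat.mul_le_mul_left k (by omega)).trans hkq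
      have h2 : ((k:ℤ) * b).natAbs ≤ X := by
        rw [Int.natAbs_mul, Int.natAbs_natCast]
        exact (Nat.mul_le_mul_left k (by omega)).trans hkq
      have hk0 : (k:ℤ) ≠ 0 := by omega
      simp only [coe_filter, mem_product, mem_Icc, Set.mem_ofPred_eq]
      refine ⟨⟨⟨by omega, by omega⟩, by omega, by omega⟩, ?_, ?_, ?_⟩
      · intro h0
        have := hsmall _ (by omega) h0
        exact (mul_ne_zero hk0 ha0) this
      · intro h0
        have := hsmall _ (by omega) h0
        exact (mul_ne_zero hk0 hb0) this
      · push_cast; rw [hab]; ring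
    · intro k _ k' _ hkk
      simp only [Prod.mk.injEq] at hkk
      have := mul_right_cancel₀ ha0 hkk.1
      exact_mod_cast this
  have hpR : (0:ℝ) < p := by exact_mod_cast hp.out.pos
  have hqR : (0:ℝ) < q := by exact_mod_cast hq
  have hXR : (0:ℝ) < X := by exact_mod_cast hX
  have h1 : (NN p ρ (Ico L₁ (L₁ + H)) (Ico L₂ (L₂ + H)) : ℝ) ≤
      (4 * q * H / p + 2) * (H / q + 1) := by
    refine (Nat.cast_le.mpr h).trans ?_
    push_cast
    have e1 : ((4 * q * H / p : ℕ) : ℝ) ≤ 4 * q * H / p := by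
      refine Nat.cast_div_le.trans ?_
      push_cast; rfl
    have e2 : ((H / q : ℕ) : ℝ) ≤ H / q := Nat.cast_div_le
    gcongr
  have h2 : (1:ℝ) / q ≤ 1 / X * (1 + Z) := by
    rw [div_mul_eq_mul_div, one_mul, div_le_div_iff₀ hqR hXR, one_mul]
    have e1 : X < q * (X / q + 1) := Nat.lt_mul_div_succ X hq
    have e2 : q * (X / q + 1) ≤ q * (Z + 1) := Nat.mul_le_mul_left q (by omega)
    have e3 : X ≤ q * (Z + 1) := by omega
    have : (X:ℝ) ≤ q * (Z + 1) := by exact_mod_cast e3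
    linarith
  have h3 : (q:ℝ) / p ≤ 1 / q := by
    rw [div_le_div_iff₀ hpR hqR, one_mul]
    have : (q:ℝ)^2 ≤ p := by exact_mod_cast hqp
    nlinarith
  have hH : (0:ℝ) ≤ H := by positivity
  calc (NN p ρ (Ico L₁ (L₁ + H)) (Ico L₂ (L₂ + H)) : ℝ) ≤ _ := h1
    _ = 4 * (H:ℝ)^2 / p + 4 * H * (q / p) + 2 * H * (1 / q) + 2 := by field_simp; ring
    _ ≤ 4 * (H:ℝ)^2 / p + 4 * H * (1 / q) + 2 * H * (1 / q) + 2 := by gcongr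
    _ = 4 * (H:ℝ)^2 / p + 2 + 6 * H * (1/q) := by ring
    _ ≤ 4 * (H:ℝ)^2 / p + 2 + 6 * H * (1 / X * (1 + Z)) := by gcongr
    _ ≤ 6 * (1 + (H:ℝ)^2 / p + (H:ℝ) / X * (1 + Z)) := by
      have e1 : 6 * H * (1 / X * (1 + Z)) = 6 * ((H:ℝ) / X * (1 + Z)) := by ring
      have e2 : 4 * (H:ℝ)^2 / p = 4 * ((H:ℝ)^2 / p) := by ring
      have e3 : 0 ≤ (H:ℝ)^2 / p := by positivity
      rw [e1, e2]; linarith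


/-- multiplicative energy set -/
def EE (p s : ℕ) (A : Finset (ZMod p)) (I : Finset ℤ) : Finset ((ZMod p × ZMod p) × (ℤ × ℤ)) :=
  ((A ×ˢ A) ×ˢ (I ×ˢ I)).filter (fun t => (t.2.1 : ZMod p) ≠ 0 ∧ (t.2.2 : ZMod p) ≠ 0 ∧
    t.1.1 * (t.2.2 : ZMod p) ^ s = t.1.2 * (t.2.1 : ZMod p) ^ s)

def cnt (p s : ℕ) (I : Finset ℤ) (mm : ZMod p × ZMod p) : Finset (ℤ × ℤ) :=
  (I ×ˢ I).filter (fun t => (t.1 : ZMod p) ≠ 0 ∧ (t.2 : ZMod p) ≠ 0 ∧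
    mm.1 * (t.2 : ZMod p) ^ s = mm.2 * (t.1 : ZMod p) ^ s)

theorem card_EE (p s : ℕ) (A : Finset (ZMod p)) (I : Finset ℤ) :
    (EE p s A I).card = ∑ mm ∈ A ×ˢ A, (cnt p s I mm).card := by
  unfold EE cnt
  simp only [card_filter]
  rw [sum_product]

theorem roots_card (p : ℕ) [hp : Fact p.Prime] (s : ℕ) (hs : 0 < s) (c : ZMod p) :
    ((univ : Finset (ZMod p)).filter (fun ρ => ρ ^ s = c)).card ≤ s := by
  classical
  refine le_trans ?_ (Polynomial.card_nthRoots s c)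
  refine le_trans ?_ (Multiset.toFinset_card_le _)
  apply card_le_card
  intro ρ h
  simp only [mem_filter, mem_univ, true_and] at h
  rw [Multiset.mem_toFinset, Polynomial.mem_nthRoots hs]
  exact h

theorem energy_one (p s : ℕ) [hp : Fact p.Prime] (hs : 0 < s) (mm : ZMod p × ZMod p)
    (h1 : mm.1 ≠ 0) (h2 : mm.2 ≠ 0) (X : ℕ) (hX : 1 ≤ X) (hXp : X < p) (L : ℤ) (H : ℕ) :
    ((cnt p s (Ico L (L + H)) mm).card : ℝ) ≤
      6 * s * (1 + (H:ℝ)^2 / p + (H:ℝ) / X) + 6 * ((H:ℝ) / X) * (cnt p s (Icc (-(X:ℤ)) X) mm).card := by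
  classical
  set R := (univ : Finset (ZMod p)).filter (fun ρ => ρ ^ s = mm.1 / mm.2) with hR
  have hRc : R.card ≤ s := roots_card p s hs _
  have hR0 : ∀ ρ ∈ R, ρ ≠ 0 := by
    intro ρ hρ h0
    simp only [hR, mem_filter, mem_univ, true_and] at hρ
    rw [h0, zero_pow hs.ne'] at hρ
    exact (div_ne_zero h1 h2) hρ.symm
  set Z : ZMod p → Finset (ℤ × ℤ) := fun ρ => (Icc (-(X:ℤ)) X ×ˢ Icc (-(X:ℤ)) X).filter
          (fun t => (t.1 : ZMod p) ≠ 0 ∧ (t.2 : ZMod p) ≠ 0 ∧ (t.1 : ZMod p) = ρ * t.2) with hZ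
  have e1 : (cnt p s (Ico L (L + H)) mm).card ≤
      ∑ ρ ∈ R, NN p ρ (Ico L (L + H)) (Ico L (L + H)) := by
    unfold NN
    refine le_trans (card_le_card ?_) card_biUnion_le
    intro t ht
    simp only [cnt, mem_filter] at ht
    obtain ⟨ht, hx, hy, he⟩ := ht
    simp only [mem_biUnion, mem_filter, hR, mem_univ, true_and]
    refine ⟨(t.1 : ZMod p) / t.2, ?_, ht, ?_⟩
    · rw [div_pow, div_eq_div_iff (pow_ne_zero _ hy) h2]
      linear_combination -he
    · field_simp
  have e2 : ∑ ρ ∈ R, (Z ρ).card ≤ (cnt p s (Icc (-(X:ℤ)) X) mm).card := by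
    rw [← card_biUnion]
    · apply card_le_card
      intro t ht
      simp only [mem_biUnion, hZ, mem_filter, hR, mem_univ, true_and] at ht
      obtain ⟨ρ, hρ, ht, hx, hy, he⟩ := ht
      simp only [cnt, mem_filter]
      refine ⟨ht, hx, hy, ?_⟩
      rw [he, mul_pow, hρ]; field_simp
    · intro ρ _ ρ' _ hne
      simp only [Function.onFun]
      rw [disjoint_left]
      intro t ht ht'
      simp only [hZ, mem_filter] at ht ht'
      apply hne
      have := ht.2.2.2.symm.trans ht'.2.2.2
      exact mul_right_cancel₀ ht.2.2.1 this
  have hHX : (0:ℝ) ≤ (H:ℝ) / X := by positivity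
  have hpp : (0:ℝ) ≤ 1 + (H:ℝ)^2 / p + (H:ℝ)/X := by positivity
  calc ((cnt p s (Ico L (L + H)) mm).card : ℝ)
      ≤ ∑ ρ ∈ R, (NN p ρ (Ico L (L + H)) (Ico L (L + H)) : ℝ) := by exact_mod_cast e1
    _ ≤ ∑ ρ ∈ R, (6 * (1 + (H:ℝ)^2 / p + (H:ℝ) / X * (1 + (Z ρ).card))) := by
        apply sum_le_sum
        intro ρ hρ
        exact lattice_real p ρ (hR0 ρ hρ) X hX hXp L L H
    _ = ∑ ρ ∈ R, (6 * (1 + (H:ℝ)^2 / p + (H:ℝ) / X) + 6 * ((H:ℝ)/X) * (Z ρ).card) := by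
        apply sum_congr rfl; intro ρ _; ring
    _ = R.card * (6 * (1 + (H:ℝ)^2 / p + (H:ℝ) / X)) + 6 * ((H:ℝ)/X) * ((∑ ρ ∈ R, (Z ρ).card : ℕ) : ℝ) := by
        rw [sum_add_distrib, sum_const, ← mul_sum, nsmul_eq_mul]; push_cast; rfl
    _ ≤ s * (6 * (1 + (H:ℝ)^2 / p + (H:ℝ) / X)) + 6 * ((H:ℝ)/X) * (cnt p s (Icc (-(X:ℤ)) X) mm).card := by
        gcongr
    _ = _ := by ring

theorem energy_two (p s : ℕ) [hp : Fact p.Prime] (hs : 0 < s) (A : Finset (ZMod p))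
    (hA : ∀ m ∈ A, m ≠ 0) (X : ℕ) (hX : 1 ≤ X) (hXp : X < p) (L : ℤ) (H : ℕ) :
    ((EE p s A (Ico L (L + H))).card : ℝ) ≤
      6 * s * (A.card:ℝ)^2 * (1 + (H:ℝ)^2 / p + (H:ℝ) / X)
        + 6 * ((H:ℝ) / X) * (EE p s A (Icc (-(X:ℤ)) X)).card := by
  rw [card_EE, card_EE]
  push_cast
  calc _ ≤ ∑ mm ∈ A ×ˢ A, (6 * s * (1 + (H:ℝ)^2 / p + (H:ℝ) / X) + 6 * ((H:ℝ) / X) * (cnt p s (Icc (-(X:ℤ)) X) mm).card) := by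
        apply sum_le_sum
        intro mm hmm
        rw [mem_product] at hmm
        exact energy_one p s hs mm (hA _ hmm.1) (hA _ hmm.2) X hX hXp L H
    _ = _ := by
        rw [sum_add_distrib, sum_const, ← mul_sum, nsmul_eq_mul, card_product]
        push_cast; ring

/-- Cauchy–Schwarz step -/
theorem energy_sq (p s : ℕ) [hp : Fact p.Prime] (A : Finset (ZMod p))
    (hA : ∀ m ∈ A, m ≠ 0) (X : ℕ) (hXp : X < p) (D : ℝ) (hD : DivB p D) :
    ((EE p s A (Icc (-(X:ℤ)) X)).card : ℝ) ^ 2 ≤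
      A.card * (D ^ 2 * (EE p s A (Icc (-((X^2:ℕ):ℤ)) ((X^2:ℕ):ℤ))).card) := by
  classical
  set J := Icc (-(X:ℤ)) X with hJ
  set T : ZMod p → Finset (ZMod p × (ℤ × ℤ)) := fun m' =>
    (A ×ˢ (J ×ˢ J)).filter (fun t => (t.2.1 : ZMod p) ≠ 0 ∧ (t.2.2 : ZMod p) ≠ 0 ∧
    t.1 * (t.2.2 : ZMod p) ^ s = m' * (t.2.1 : ZMod p) ^ s) with hT
  have e1 : (EE p s A J).card = ∑ m' ∈ A, (T m').card := by
    unfold EE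
    simp only [hT, card_filter]
    rw [sum_product, sum_product_right]
    apply sum_congr rfl; intro m' _
    rw [sum_product]
  set W : Finset ((m' : ZMod p) × ((ZMod p × (ℤ × ℤ)) × (ZMod p × (ℤ × ℤ)))) :=
    A.sigma (fun m' => T m' ×ˢ T m') with hW
  have e2 : ∑ m' ∈ A, (T m').card ^ 2 = W.card := by
    rw [hW, card_sigma]
    apply sum_congr rfl; intro m' _
    rw [card_product, sq]
  have e3 : (W.card : ℝ) ≤ D^2 * (EE p s A (Icc (-((X^2:ℕ):ℤ)) ((X^2:ℕ):ℤ))).card := by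
    set F : ((m' : ZMod p) × ((ZMod p × (ℤ × ℤ)) × (ZMod p × (ℤ × ℤ)))) → (ZMod p × ZMod p) × (ℤ × ℤ) :=
      fun w => ((w.2.1.1, w.2.2.1), (w.2.2.2.2 * w.2.1.2.1, w.2.1.2.2 * w.2.2.2.1)) with hF
    have hmem : ∀ w ∈ W, F w ∈ EE p s A (Icc (-((X^2:ℕ):ℤ)) ((X^2:ℕ):ℤ)) := by
      intro w hw
      simp only [hW, mem_sigma, mem_product, hT, mem_filter, hJ, mem_Icc] at hw
      obtain ⟨hm', ⟨⟨hm1, ⟨a1, a2⟩, a3, a4⟩, a5, a6, a7⟩, ⟨⟨hm2, ⟨b1, b2⟩, b3, b4⟩, b5, b6, b7⟩⟩ := hw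
      simp only [EE, hF, mem_filter, mem_product, mem_Icc]
      have hb : ∀ x y : ℤ, -(X:ℤ) ≤ x → x ≤ X → -(X:ℤ) ≤ y → y ≤ X →
          -((X^2:ℕ):ℤ) ≤ x * y ∧ x * y ≤ ((X^2:ℕ):ℤ) := by
        intro x y h1 h2 h3 h4
        rw [← abs_le, abs_mul]
        push_cast
        rw [sq]
        exact mul_le_mul (abs_le.mpr ⟨h1, h2⟩) (abs_le.mpr ⟨h3, h4⟩) (abs_nonneg _) (by positivity)
      refine ⟨⟨⟨hm1, hm2⟩, hb _ _ b3 b4 a1 a2, hb _ _ a3 a4 b1 b2⟩, ?_, ?_, ?_⟩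
      · push_cast; exact mul_ne_zero b6 a5
      · push_cast; exact mul_ne_zero a6 b5
      · push_cast
        rw [mul_pow, mul_pow]
        linear_combination (w.2.2.2.1 : ZMod p)^s * a7 - (w.2.1.2.1 : ZMod p)^s * b7
    have hfib : ∀ y ∈ EE p s A (Icc (-((X^2:ℕ):ℤ)) ((X^2:ℕ):ℤ)),
        ((W.filter (fun w => F w = y)).card : ℝ) ≤ D ^ 2 := by
      intro y hy
      simp only [EE, mem_filter] at hy
      obtain ⟨-, hy1, hy2, -⟩ := hy
      have hy1' : y.2.1 ≠ 0 := by intro h; rw [h] at hy1; simp at hy1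
      have hy2' : y.2.2 ≠ 0 := by intro h; rw [h] at hy2; simp at hy2
      have d1 := hD.2 X hXp y.2.1 hy1'
      have d2 := hD.2 X hXp y.2.2 hy2'
      have hle : (W.filter (fun w => F w = y)).card ≤
          (((J ×ˢ J).filter (fun t => t.1 * t.2 = y.2.1)) ×ˢ
            ((J ×ˢ J).filter (fun t => t.1 * t.2 = y.2.2))).card := by
        apply card_le_card_of_injOn (fun w => ((w.2.2.2.2, w.2.1.2.1), (w.2.1.2.2, w.2.2.2.1)))
        · intro w hw
          simp only [coe_filter, Set.mem_ofPred_eq, hW, mem_sigma, mem_product, hT, mem_filter] at hw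
          obtain ⟨⟨hm', ⟨⟨hm1, a1, a2⟩, a5, a6, a7⟩, ⟨⟨hm2, b1, b2⟩, b5, b6, b7⟩⟩, hFy⟩ := hw
          simp only [coe_product, coe_filter, Set.mem_prod, Set.mem_ofPred_eq, mem_product]
          rw [← hFy]
          exact ⟨⟨⟨b2, a1⟩, rfl⟩, ⟨a2, b1⟩, rfl⟩
        · intro w hw w' hw' h
          simp only [coe_filter, Set.mem_ofPred_eq, hW, mem_sigma, mem_product, hT, mem_filter] at hw hw'
          obtain ⟨⟨hm', ⟨⟨hm1, a1, a2⟩, a5, a6, a7⟩, ⟨⟨hm2, b1, b2⟩, b5, b6, b7⟩⟩, hFy⟩ := hw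
          obtain ⟨⟨hm'', ⟨⟨hm1', a1', a2'⟩, a5', a6', a7'⟩, ⟨⟨hm2', b1', b2'⟩, b5', b6', b7'⟩⟩, hFy'⟩ := hw'
          have hFF := hFy.trans hFy'.symm
          rcases w with ⟨m', ⟨m1, u, v⟩, ⟨m2, u2, v2⟩⟩
          rcases w' with ⟨n', ⟨n1, x, y'⟩, ⟨n2, x2, y2⟩⟩
          simp only [hF, Prod.mk.injEq] at hFF h ⊢
          obtain ⟨⟨h1, h2⟩, h3, h4⟩ := h
          obtain ⟨⟨g1, g2⟩, -⟩ := hFF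
          subst h1 h2 h3 h4 g1 g2
          simp only at a7 a7' a5
          have : m' = n' := mul_right_cancel₀ (pow_ne_zero s a5) (a7.symm.trans a7')
          subst this
          rfl
      calc ((W.filter (fun w => F w = y)).card : ℝ) ≤ _ := Nat.cast_le.mpr hle
        _ ≤ D * D := by
          rw [card_product]; push_cast
          exact mul_le_mul d1 d2 (by positivity) (by linarith [hD.1])
        _ = D ^ 2 := by ring
    rw [card_eq_sum_card_fiberwise (f := F) (t := EE p s A (Icc (-((X^2:ℕ):ℤ)) ((X^2:ℕ):ℤ))) hmem]
    push_cast
    calc _ ≤ ∑ y ∈ EE p s A (Icc (-((X^2:ℕ):ℤ)) ((X^2:ℕ):ℤ)), D^2 := sum_le_sum (by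
          intro y hy; exact hfib y hy)
      _ = _ := by rw [sum_const, nsmul_eq_mul]; push_cast; ring
  calc ((EE p s A J).card : ℝ) ^ 2 = (∑ m' ∈ A, ((T m').card : ℝ)) ^ 2 := by rw [e1]; push_cast; rfl
    _ ≤ A.card * ∑ m' ∈ A, ((T m').card : ℝ) ^ 2 := sq_sum_le_card_mul_sum_sq
    _ = A.card * (W.card : ℝ) := by rw [← e2]; push_cast; rfl
    _ ≤ _ := by gcongr


theorem energy_F_aux (F G M X s D q p h : ℝ) (hM0 : 0 ≤ M) (hF0 : 0 ≤ F) (hX1 : 1 ≤ X)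
    (hs1 : 1 ≤ s) (hD1 : 1 ≤ D) (hp0 : 0 < p) (hq : 1 ≤ q) (hq4 : q ^ 4 = M * p)
    (hh0 : 0 ≤ h) (hh : h ≤ 3 * X ^ 2)
    (h1 : F ^ 2 ≤ M * (D ^ 2 * G))
    (h2 : G ≤ 6 * s * M ^ 2 * (1 + h ^ 2 / p + h / X) + 6 * (h / X) * F) :
    F ≤ X * (108 * s * D ^ 2 * (M + M ^ 2 / X + M ^ 2 * X / q ^ 2)) := by
  have hX0 : 0 < X := by linarith
  obtain ⟨f, hFf⟩ : ∃ f, F = X * f := ⟨F / X, by field_simp⟩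
  have hf0 : 0 ≤ f := by
    by_contra hc
    push Not at hc
    have := mul_neg_of_pos_of_neg hX0 hc
    linarith
  obtain ⟨K, hK⟩ : ∃ K, K = 54 * s * D ^ 2 := ⟨_, rfl⟩
  have hD2 : 1 ≤ D^2 := by nlinarith
  have hK1 : 1 ≤ K := by rw [hK]; nlinarith
  have hG' : G ≤ 54 * s * (M^2 * (X^4 / p + X) + X * F) := by
    refine h2.trans ?_
    calc 6 * s * M^2 * (1 + h^2 / p + h / X) + 6 * (h / X) * F
        ≤ 6 * s * M^2 * (X + (3*X^2)^2 / p + (3 * X^2) / X) + 6 * ((3 * X^2) / X) * F := by gcongr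
      _ = 6 * s * M^2 * (X + 9 * (X^4 / p) + 3 * X) + 18 * (X * F) := by field_simp; ring
      _ ≤ 6 * s * M^2 * (9 * X + 9 * (X^4 / p)) + 54 * s * (X * F) := by
          have h0 : 0 ≤ X * F := by positivity
          have h3 : 18 * (X * F) ≤ 54 * s * (X * F) := by nlinarith
          have h4 : X + 9 * (X^4 / p:ℝ) + 3 * X ≤ 9 * X + 9 * (X^4 / p) := by linarith
          gcongr
      _ = _ := by ring
  obtain ⟨r, hr⟩ : ∃ r, r = M ^ 2 * X / q ^ 2 := ⟨_, rfl⟩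
  have hmain : f ^ 2 ≤ K * (r^2 + M^3 / X + M * f) := by
    have hF2 : F^2 ≤ M * (D^2 * (54 * s * (M^2 * (X^4 / p + X) + X * F))) := by
      refine h1.trans ?_; gcongr
    have h3 : r^2 = M^3 * X^2 / p := by
      have : r^2 = M^4 * X^2 / q^4 := by rw [hr]; ring
      rw [this, hq4]
      by_cases h0 : M = 0
      · simp [h0]
      · field_simp
    rw [h3]
    have h4 : X^2 * f^2 ≤ X^2 * (K * (M^3 * X^2 / p + M^3 / X + M * f)) := by
      have e1 : X^2 * f^2 = F^2 := by rw [hFf]; ring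
      have e2 : X^2 * (K * (M^3 * X^2 / p + M^3 / X + M * f)) = M * (D^2 * (54 * s * (M^2 * (X^4 / p + X) + X * F))) := by
        rw [hK, hFf]; field_simp
      rw [e1, e2]; exact hF2
    exact le_of_mul_le_mul_left h4 (by positivity)
  have hr0 : 0 ≤ r := by rw [hr]; positivity
  obtain ⟨v, hv⟩ : ∃ v, v = M ^ 2 / X := ⟨_, rfl⟩
  have hv0 : 0 ≤ v := by rw [hv]; positivity
  have hMX : M^3 / X ≤ (M + v)^2 := by
    have : M^3 / X = M * v := by rw [hv]; ring
    rw [this]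
    nlinarith [mul_nonneg hM0 hv0]
  have hgoal : f ≤ 2 * K * (M + v + r) := by
    by_contra hcon
    push Not at hcon
    have h5 : M * f * (2 * K) ≤ f ^ 2 := by
      have h0 : 0 ≤ 2 * K * (v + r) := by positivity
      have : 2 * K * M ≤ f := by linarith
      calc M * f * (2 * K) = (2 * K * M) * f := by ring
        _ ≤ f * f := by gcongr
        _ = _ := by ring
    have h6 : r^2 + (M+v)^2 ≤ (M + v + r)^2 := by
      have : 0 ≤ r * (M + v) := by positivity
      linarith [this, (by ring : (M + v + r)^2 = r^2 + (M+v)^2 + 2 * (r * (M + v)))]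
    have h6' : K * (r^2 + M^3 / X) ≤ K * (M + v + r)^2 := by
      gcongr; linarith
    have h7 : f^2 ≤ 2 * (K * (M + v + r)^2) := by
      have : K * (r^2 + M^3 / X + M * f) = K * (r^2 + M^3 / X) + (M * f * (2 * K))/2 := by ring
      linarith
    have h8 : (2 * K * (M+v+r))^2 < f^2 := by
      apply pow_lt_pow_left₀ hcon (by positivity) (by norm_num)
    have h9 : 2 * (K * (M + v + r)^2) ≤ (2 * K * (M+v+r))^2 := by
      have : (2 * K * (M+v+r))^2 = (2 * K) * (2 * (K * (M + v + r)^2)) := by ring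
      rw [this]
      apply le_mul_of_one_le_left (by positivity) (by linarith)
    linarith
  have e1 : F ≤ X * (2 * K * (M + v + r)) := by rw [hFf]; gcongr
  have : 2 * K = 108 * s * D^2 := by rw [hK]; ring
  rw [this, hv, hr] at e1
  exact e1

theorem energy_F (p s : ℕ) [hp : Fact p.Prime] (hs : 0 < s) (A : Finset (ZMod p))
    (hA : ∀ m ∈ A, m ≠ 0) (X : ℕ) (hX : 1 ≤ X) (hXp : X < p) (D : ℝ) (hD : DivB p D)
    (q : ℝ) (hq : 1 ≤ q) (hq4 : q ^ 4 = A.card * p) :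
    ((EE p s A (Icc (-(X:ℤ)) X)).card : ℝ) ≤
      X * (108 * s * D ^ 2 * (A.card + (A.card:ℝ)^2 / X + (A.card:ℝ)^2 * X / q^2)) := by
  have h1 := energy_sq p s A hA X hXp D hD
  have h2 := energy_two p s hs A hA X hX hXp (-((X^2:ℕ):ℤ)) (2 * X^2 + 1)
  have e : Ico (-((X^2:ℕ):ℤ)) (-((X^2:ℕ):ℤ) + ((2 * X^2 + 1 : ℕ):ℤ)) = Icc (-((X^2:ℕ):ℤ)) ((X^2:ℕ):ℤ) := by
    ext t; simp only [mem_Ico, mem_Icc]; push_cast; constructor <;> rintro ⟨h, h'⟩ <;> constructor <;> linarith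
  rw [e] at h2
  have hX1 : (1:ℝ) ≤ X := by exact_mod_cast hX
  refine energy_F_aux _ _ _ _ _ _ _ _ _ (by positivity) (by positivity) hX1 (by exact_mod_cast hs) hD.1
    (by exact_mod_cast hp.out.pos) hq hq4 (by positivity) ?_ h1 h2
  push_cast
  nlinarith

theorem energy_final (p s : ℕ) [hp : Fact p.Prime] (hs : 0 < s) (A : Finset (ZMod p))
    (hA : ∀ m ∈ A, m ≠ 0) (D : ℝ) (hD : DivB p D)
    (q : ℝ) (hq : 1 ≤ q) (hq4 : q ^ 4 = A.card * p) (L : ℤ) (H : ℕ) (hH : 1 ≤ H) (hHp : H < p) :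
    ((EE p s A (Ico L (L + H))).card : ℝ) ≤ 
      2000 * s * D^2 * ((A.card:ℝ)^2 + (A.card:ℝ)^2 * H^2 / p + H * A.card + H * ((A.card:ℝ)^2 / q)) := by
  set X := min H ⌈q⌉₊ with hXdef
  have hX : 1 ≤ X := by
    rw [hXdef, le_min_iff]; exact ⟨hH, Nat.one_le_ceil_iff.mpr (by linarith)⟩
  have hXH : X ≤ H := min_le_left _ _
  have hXp : X < p := by omega
  have h1 := energy_two p s hs A hA X hX hXp L H
  have h2 := energy_F p s hs A hA X hX hXp D hD q hq hq4
  set M : ℝ := (A.card : ℝ)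
  have hM0 : 0 ≤ M := by positivity
  have hX1 : (1:ℝ) ≤ X := by exact_mod_cast hX
  have hs1 : (1:ℝ) ≤ s := by exact_mod_cast hs
  have hD1 := hD.1
  have hD2 : 1 ≤ D^2 := by nlinarith
  have hp0 : (0:ℝ) < p := by exact_mod_cast hp.out.pos
  have hXq : (X:ℝ) ≤ 2 * q := by
    have : (X:ℝ) ≤ ⌈q⌉₊ := by exact_mod_cast min_le_right _ _
    have := Nat.ceil_lt_add_one (show 0 ≤ q by linarith)
    linarith
  have hr : M^2 * X / q^2 ≤ 2 * (M^2/q) := by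
    calc M^2 * X / q^2 ≤ M^2 * (2 * q) / q^2 := by gcongr
      _ = _ := by field_simp
  have hMX : H * (M^2 / X) ≤ M^2 + H * (M^2/q) := by
    rcases le_total H ⌈q⌉₊ with h | h
    · have : X = H := min_eq_left h
      have hH0 : (0:ℝ) < H := by exact_mod_cast hH
      rw [this]
      have : (H:ℝ) * (M^2/H) = M^2 := by field_simp
      rw [this]
      have : 0 ≤ H * (M^2/q) := by positivity
      linarith
    · have : X = ⌈q⌉₊ := min_eq_right h
      rw [this]
      have hc := Nat.le_ceil q
      have : H * (M^2 / ⌈q⌉₊) ≤ H * (M^2/q) := by gcongr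
      have := sq_nonneg M
      linarith
  set P := M^2 / q
  set Q := M^2 / X
  set K := 108 * (s:ℝ) * D^2 with hK
  have hsD : (s:ℝ) ≤ s * D^2 := by nlinarith
  have hP : 0 ≤ P := by positivity
  have hQ : 0 ≤ Q := by positivity
  calc ((EE p s A (Ico L (L + H))).card : ℝ)
      ≤ 6 * s * M^2 * (1 + (H:ℝ)^2 / p + (H:ℝ) / X)
        + 6 * ((H:ℝ) / X) * (X * (K * (M + Q + 2 * P))) := by
          refine h1.trans ?_; gcongr; exact h2.trans (by gcongr)
    _ = 6 * s * (M^2 + M^2 * H^2/p + H * Q) + 6 * K * (H * M + H * Q + 2 * (H * P)) := by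
          simp only [Q]; field_simp
    _ ≤ 6 * (s * D^2) * (M^2 + M^2 * H^2/p + (M^2 + H * P)) + 6 * K * (H * M + (M^2 + H * P) + 2 * (H * P)) := by
          gcongr
    _ ≤ _ := by
          have : 2000 * s * D^2 * (M^2 + M^2 * H^2 / p + H * M + H * P) -
            (6 * (s * D^2) * (M^2 + M^2 * H^2/p + (M^2 + H * P)) + 6 * K * (H * M + (M^2 + H * P) + 2 * (H * P)))
            = s * D^2 * (1340 * M^2 + 1994 * (M^2*H^2/p) + 1352 * (H * M) + 50 * (H * P)) := by
              rw [hK]; ring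
          have : 0 ≤ s * D^2 * (1340 * M^2 + 1994 * (M^2*H^2/p) + 1352 * (H * M) + 50 * (H * P)) := by positivity
          linarith


noncomputable def ee (p : ℕ) [NeZero p] (x : ZMod p) : ℂ := ZMod.stdAddChar x

theorem ee_add (p : ℕ) [NeZero p] (x y : ZMod p) : ee p (x + y) = ee p x * ee p y :=
  AddChar.map_add_eq_mul _ _ _

theorem ee_norm (p : ℕ) [NeZero p] (x : ZMod p) : ‖ee p x‖ = 1 := by
  unfold ee; exact AddChar.norm_apply _ _

theorem ee_zero (p : ℕ) [NeZero p] : ee p 0 = 1 := AddChar.map_zero_eq_one _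

theorem ee_sum (p : ℕ) [NeZero p] {ι : Type*} (I : Finset ι) (f : ι → ZMod p) :
    ee p (∑ i ∈ I, f i) = ∏ i ∈ I, ee p (f i) := by
  classical
  induction I using Finset.induction_on with
  | empty => simp [ee_zero]
  | insert a I ha ih => rw [sum_insert ha, prod_insert ha, ee_add, ih]

theorem ee_conj (p : ℕ) [NeZero p] (x : ZMod p) : (starRingEnd ℂ) (ee p x) = ee p (-x) := by
  unfold ee; exact (AddChar.map_neg_eq_conj _ _).symm

theorem ee_orth (p : ℕ) [Fact p.Prime] (c : ZMod p) :
    ∑ a : ZMod p, ee p (a * c) = if c = 0 then (p:ℂ) else 0 := by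
  unfold ee
  have := AddChar.sum_mulShift c (ZMod.isPrimitive_stdAddChar p)
  rw [ZMod.card] at this
  rw [this]
  split_ifs <;> simp

theorem orth_sq (p : ℕ) [Fact p.Prime] {ι : Type*} (I : Finset ι) (c : ι → ZMod p) :
    ∑ a : ZMod p, ‖∑ i ∈ I, ee p (a * c i)‖ ^ 2 =
      p * (((I ×ˢ I).filter (fun t => c t.1 = c t.2)).card : ℝ) := by
  classical
  have h : ∀ a : ZMod p, ((‖∑ i ∈ I, ee p (a * c i)‖ ^ 2 : ℝ) : ℂ) =
      ∑ t ∈ I ×ˢ I, ee p (a * (c t.1 - c t.2)) := by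
    intro a
    push_cast
    rw [← Complex.mul_conj', map_sum, sum_mul_sum, ← sum_product']
    apply sum_congr rfl
    intro t _
    rw [ee_conj, ← ee_add]; congr 1; ring
  have h2 : ((∑ a : ZMod p, ‖∑ i ∈ I, ee p (a * c i)‖ ^ 2 : ℝ) : ℂ) =
     ((p * (((I ×ˢ I).filter (fun t => c t.1 = c t.2)).card : ℝ) : ℝ) : ℂ) := by
    rw [Complex.ofReal_sum, sum_congr rfl (fun a _ => h a), sum_comm]
    rw [sum_congr rfl (fun t _ => ee_orth p (c t.1 - c t.2))]
    simp only [sub_eq_zero]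
    rw [← sum_filter, sum_const, nsmul_eq_mul]
    push_cast; ring
  exact_mod_cast h2

/-- the basic sum -/
noncomputable def SS (p s : ℕ) [NeZero p] (A : Finset (ZMod p)) (L : ℤ) (H : ℕ) : ℂ :=
  ∑ m ∈ A, ∑ j ∈ range H, ee p (m * ((((L + j : ℤ) : ZMod p)) ^ s)⁻¹)

theorem SS_trivial (p s : ℕ) [NeZero p] (A : Finset (ZMod p)) (L : ℤ) (H : ℕ) :
    ‖SS p s A L H‖ ≤ A.card * H := by
  unfold SS
  refine (norm_sum_le _ _).trans ?_
  calc _ ≤ ∑ m ∈ A, (H:ℝ) := by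
        apply sum_le_sum; intro m _
        refine (norm_sum_le _ _).trans ?_
        simp [ee_norm]
    _ = _ := by simp

theorem SS_eq (p s : ℕ) [NeZero p] (A : Finset (ZMod p)) (L : ℤ) (H : ℕ) :
    SS p s A L H = ∑ t ∈ A ×ˢ Ico L (L + H), ee p (t.1 * (((t.2 : ℤ) : ZMod p) ^ s)⁻¹) := by
  unfold SS
  rw [sum_product]
  apply sum_congr rfl; intro m _
  refine sum_bij (fun j _ => L + (j:ℤ)) ?_ ?_ ?_ ?_
  · intro j hj; simp only [mem_range] at hj; simp only [mem_Ico]; constructor <;> omega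
  · intro a _ b _ h; simpa using h
  · intro x hx; simp only [mem_Ico] at hx
    refine ⟨(x - L).toNat, ?_, ?_⟩
    · simp only [mem_range]; omega
    · omega
  · intro j _; rfl

/-- the set dilated by `a` -/
theorem SS_dilate (p s : ℕ) [Fact p.Prime] (A : Finset (ZMod p)) (a : ZMod p) (ha : a ≠ 0) (L : ℤ) (H : ℕ) :
    SS p s (A.image (fun m => a * m)) L H =
      ∑ t ∈ A ×ˢ Ico L (L + H), ee p (a * (t.1 * (((t.2 : ℤ) : ZMod p) ^ s)⁻¹)) := by
  rw [SS_eq, sum_product, sum_product, sum_image]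
  · apply sum_congr rfl; intro m _; apply sum_congr rfl; intro x _; simp only [mul_assoc]
  · intro x _ y _ h; exact mul_left_cancel₀ ha h

theorem SS_add (p s : ℕ) [NeZero p] (A : Finset (ZMod p)) (L : ℤ) (H t : ℕ) :
    SS p s A L (H + t) = SS p s A L H + SS p s A (L + H) t := by
  unfold SS
  rw [← sum_add_distrib]
  apply sum_congr rfl; intro m _
  rw [sum_range_add]
  congr 1
  apply sum_congr rfl; intro j _
  push_cast; simp only [add_assoc]

theorem SS_shift (p s : ℕ) [NeZero p] (A : Finset (ZMod p)) (L : ℤ) (H t : ℕ) :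
    SS p s A L H = SS p s A (L + t) H + SS p s A L t - SS p s A (L + H) t := by
  have h1 := SS_add p s A L H t
  have h2 := SS_add p s A L t H
  rw [add_comm t H] at h2
  linear_combination h2 - h1

theorem L2_energy (p s : ℕ) [hp : Fact p.Prime] (A : Finset (ZMod p)) (L : ℤ) (H : ℕ)
    (hx : ∀ x ∈ Ico L (L + H), (x : ZMod p) ≠ 0) :
    ∑ a : ZMod p, ‖∑ t ∈ A ×ˢ Ico L (L + H), ee p (a * (t.1 * (((t.2 : ℤ) : ZMod p) ^ s)⁻¹))‖ ^ 2
      = p * ((EE p s A (Ico L (L + H))).card : ℝ) := by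
  rw [orth_sq]
  congr 2
  refine card_bij (fun t _ => ((t.1.1, t.2.1), (t.1.2, t.2.2))) ?_ ?_ ?_
  · intro t ht
    simp only [mem_filter, mem_product] at ht
    obtain ⟨⟨⟨h1, h2⟩, h3, h4⟩, he⟩ := ht
    have g1 := hx _ h2
    have g2 := hx _ h4
    simp only [EE, mem_filter, mem_product]
    refine ⟨⟨⟨h1, h3⟩, h2, h4⟩, g1, g2, ?_⟩
    field_simp at he
    linear_combination he
  · rintro ⟨⟨a, b⟩, c, d⟩ _ ⟨⟨a', b'⟩, c', d'⟩ _ h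
    simp only [Prod.mk.injEq] at h ⊢
    tauto
  · rintro ⟨⟨a, b⟩, c, d⟩ ht
    simp only [EE, mem_filter, mem_product] at ht
    obtain ⟨⟨⟨h1, h2⟩, h3, h4⟩, h5, h6, h7⟩ := ht
    refine ⟨((a, c), (b, d)), ?_, rfl⟩
    simp only [mem_filter, mem_product]
    refine ⟨⟨⟨h1, h3⟩, h2, h4⟩, ?_⟩
    field_simp
    linear_combination h7


theorem bad_card (V : ℕ) :
    ((Fintype.piFinset (fun _ : Fin 6 => range V)).filter
      (fun t => ∀ i, ∃ j, j ≠ i ∧ t j = t i)).card ≤ 729 * V ^ 3 := by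
  classical
  have h1 : ((univ : Finset (Fin 6 → Fin 3)) ×ˢ Fintype.piFinset (fun _ : Fin 3 => range V)).card = 729 * V^3 := by
    rw [card_product, Fintype.card_piFinset]; simp
  rw [← h1]
  refine le_trans (card_le_card ?_) (card_image_le (f := fun gh : (Fin 6 → Fin 3) × (Fin 3 → ℕ) => gh.2 ∘ gh.1))
  intro t ht
  simp only [mem_filter, Fintype.mem_piFinset] at ht
  obtain ⟨ht, hbad⟩ := ht
  set B := univ.image t with hB
  have hcard : B.card ≤ 3 := by
    have e : (univ : Finset (Fin 6)).card = ∑ b ∈ B, (univ.filter (fun i => t i = b)).card :=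
      card_eq_sum_card_fiberwise (fun i _ => by simp [hB])
    have : ∑ b ∈ B, 2 ≤ ∑ b ∈ B, (univ.filter (fun i => t i = b)).card := by
      apply sum_le_sum
      intro b hb
      simp only [hB, mem_image, mem_univ, true_and] at hb
      obtain ⟨i, rfl⟩ := hb
      obtain ⟨j, hj, hji⟩ := hbad i
      have : ({i, j} : Finset (Fin 6)) ⊆ univ.filter (fun k => t k = t i) := by
        intro k hk
        simp only [mem_insert, mem_singleton] at hk
        rcases hk with rfl | rfl
        · simp
        · simp [hji]
      calc 2 = ({i, j} : Finset (Fin 6)).card := (card_pair hj.symm).symm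
        _ ≤ _ := card_le_card this
    rw [← e] at this
    simp at this
    omega
  have hne : Nonempty B := ⟨⟨t 0, by simp [hB]⟩⟩
  obtain ⟨em⟩ := Function.Embedding.nonempty_of_card_le (α := B) (β := Fin 3) (by simpa using hcard)
  simp only [mem_image, mem_product, mem_univ, true_and, Fintype.mem_piFinset]
  refine ⟨(fun i => em ⟨t i, by simp [hB]⟩, fun k => (Function.invFun em k : B).1), ?_, ?_⟩
  · intro k
    have := (Function.invFun em k : B).2
    simp only [hB, mem_image, mem_univ, true_and] at this
    obtain ⟨i, hi⟩ := this
    simp only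
    rw [← hi]; exact ht i
  · ext i
    simp only [Function.comp]
    rw [Function.leftInverse_invFun em.injective]

theorem good_card (p s : ℕ) [hp : Fact p.Prime] (hs : 0 < s) (V : ℕ) (hV : V ≤ p)
    (sg : Fin 6 → ZMod p) (hsg : ∀ i, sg i ≠ 0) (t : Fin 6 → ℕ) (ht : ∀ i, t i < V)
    (i : Fin 6) (hi : ∀ j, j ≠ i → t j ≠ t i) :
    ((univ : Finset (ZMod p)).filter (fun β : ZMod p => ∑ j, sg j * ((β + t j) ^ s)⁻¹ = 0)).card ≤ 6 + 6 * s := by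
  classical
  set P : Polynomial (ZMod p) := ∑ j, Polynomial.C (sg j) * ∏ l ∈ univ.erase j, (Polynomial.X + Polynomial.C (t l : ZMod p)) ^ s with hP
  have hev : ∀ β, P.eval β = ∑ j, sg j * ∏ l ∈ univ.erase j, (β + t l) ^ s := by
    intro β
    simp [hP, Polynomial.eval_finsetSum, Polynomial.eval_prod]
  have hP0 : P ≠ 0 := by
    intro h0
    have h := hev (-(t i : ZMod p))
    rw [h0, Polynomial.eval_zero] at h
    rw [sum_eq_single i] at h
    · have : sg i * ∏ l ∈ univ.erase i, (-(t i : ZMod p) + t l) ^ s ≠ 0 := by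
        apply mul_ne_zero (hsg i)
        rw [prod_ne_zero_iff]
        intro l hl
        apply pow_ne_zero
        intro h0
        have : ((t l : ℕ) : ZMod p) = ((t i : ℕ) : ZMod p) := by linear_combination h0
        rw [ZMod.natCast_eq_natCast_iff'] at this
        rw [Nat.mod_eq_of_lt (lt_of_lt_of_le (ht l) hV), Nat.mod_eq_of_lt (lt_of_lt_of_le (ht i) hV)] at this
        exact hi l (mem_erase.mp hl).1 this
      exact this h.symm
    · intro j _ hj
      rw [prod_eq_zero (i := i)]
      · simp
      · simp [Ne.symm hj]
      · simp [hs.ne']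
    · simp
  have hdeg : P.natDegree ≤ 6 * s := by
    rw [hP]
    apply Polynomial.natDegree_sum_le_of_forall_le
    intro j _
    refine (Polynomial.natDegree_C_mul_le _ _).trans ?_
    refine (Polynomial.natDegree_prod_le _ _).trans ?_
    calc _ ≤ ∑ l ∈ univ.erase j, s := by
          apply sum_le_sum; intro l _
          refine Polynomial.natDegree_pow_le.trans ?_
          rw [Polynomial.natDegree_X_add_C, mul_one]
      _ ≤ ∑ l : Fin 6, s := sum_le_sum_of_subset (erase_subset _ _)
      _ = 6 * s := by simp
  have hsub : (univ : Finset (ZMod p)).filter (fun β : ZMod p => ∑ j, sg j * ((β + t j) ^ s)⁻¹ = 0) ⊆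
      univ.image (fun j => -(t j : ZMod p)) ∪ P.roots.toFinset := by
    intro β hβ
    simp only [mem_filter, mem_univ, true_and] at hβ
    rw [mem_union]
    by_cases h : ∃ j, β + t j = 0
    · left
      obtain ⟨j, hj⟩ := h
      simp only [mem_image, mem_univ, true_and]
      exact ⟨j, by linear_combination -hj⟩
    · right
      push Not at h
      rw [Multiset.mem_toFinset, Polynomial.mem_roots hP0, Polynomial.IsRoot, hev]
      have : ∑ j, sg j * ∏ l ∈ univ.erase j, (β + t l) ^ s =
          (∏ l, (β + t l) ^ s) * ∑ j, sg j * ((β + t j) ^ s)⁻¹ := by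
        rw [mul_sum]
        apply sum_congr rfl
        intro j _
        rw [← mul_prod_erase univ _ (mem_univ j)]
        have := pow_ne_zero s (h j)
        field_simp
      rw [this, hβ, mul_zero]
  refine (card_le_card hsub).trans ((card_union_le _ _).trans ?_)
  have h1 : (univ.image (fun j => -(t j : ZMod p))).card ≤ 6 := by
    refine card_image_le.trans ?_; simp
  have h2 : P.roots.toFinset.card ≤ 6 * s :=
    (Multiset.toFinset_card_le _).trans ((Polynomial.card_roots' _).trans hdeg)
  omega

theorem sextic_count (p s : ℕ) [hp : Fact p.Prime] (hs : 0 < s) (V : ℕ) (hV : V ≤ p)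
    (sg : Fin 6 → ZMod p) (hsg : ∀ i, sg i ≠ 0) (B : Finset (ZMod p)) :
    ∑ β ∈ B, ((Fintype.piFinset (fun _ : Fin 6 => range V)).filter
      (fun t => ∑ j, sg j * ((β + t j) ^ s)⁻¹ = 0)).card ≤ 729 * V ^ 3 * B.card + V ^ 6 * (6 + 6 * s) := by
  classical
  set T := Fintype.piFinset (fun _ : Fin 6 => range V) with hT
  simp only [card_filter]
  rw [sum_comm]
  simp only [← card_filter]
  rw [← sum_filter_add_sum_filter_not T (fun t => ∀ i, ∃ j, j ≠ i ∧ t j = t i)]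
  apply add_le_add
  · calc _ ≤ ∑ t ∈ T.filter (fun t => ∀ i, ∃ j, j ≠ i ∧ t j = t i), B.card := by
          apply sum_le_sum; intro t _; exact card_filter_le _ _
      _ ≤ _ := by
          rw [sum_const, smul_eq_mul]
          exact Nat.mul_le_mul_right _ (bad_card V)
  · calc _ ≤ ∑ t ∈ T.filter (fun t => ¬ ∀ i, ∃ j, j ≠ i ∧ t j = t i), (6 + 6 * s) := by
          apply sum_le_sum
          intro t ht
          simp only [mem_filter, hT, Fintype.mem_piFinset, mem_range] at ht
          obtain ⟨ht, hg⟩ := ht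
          push Not at hg
          obtain ⟨i, hi⟩ := hg
          refine le_trans (card_le_card ?_) (good_card p s hs V hV sg hsg t ht i hi)
          exact filter_subset_filter _ (subset_univ _)
      _ ≤ _ := by
          rw [sum_const, smul_eq_mul]
          apply Nat.mul_le_mul_right
          refine (card_filter_le _ _).trans ?_
          rw [hT, Fintype.card_piFinset]; simp

noncomputable def ff (p s V : ℕ) [NeZero p] (α β : ZMod p) : ℂ :=
  ∑ v ∈ range V, ee p (α * ((β + v) ^ s)⁻¹)

theorem sextic_one (p s : ℕ) [hp : Fact p.Prime] (V : ℕ) (β : ZMod p) :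
    ∑ α : ZMod p, ‖ff p s V α β‖ ^ 6 = p *
      (((Fintype.piFinset (fun _ : Fin 6 => range V)).filter
      (fun t => ∑ j, (![1, 1, 1, -1, -1, -1] : Fin 6 → ZMod p) j * ((β + t j) ^ s)⁻¹ = 0)).card : ℝ) := by
  classical
  have h3 : ∀ α : ZMod p, ‖ff p s V α β‖ ^ 6 =
      ‖∑ v ∈ Fintype.piFinset (fun _ : Fin 3 => range V), ee p (α * ∑ i, ((β + v i) ^ s)⁻¹)‖ ^ 2 := by
    intro α
    have : ∑ v ∈ Fintype.piFinset (fun _ : Fin 3 => range V), ee p (α * ∑ i, ((β + v i) ^ s)⁻¹) =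
        (ff p s V α β) ^ 3 := by
      have := Finset.prod_univ_sum (fun _ : Fin 3 => range V) (fun _ v => ee p (α * ((β + v) ^ s)⁻¹))
      rw [prod_const] at this
      simp only [card_univ, Fintype.card_fin] at this
      unfold ff
      rw [this]
      apply sum_congr rfl
      intro v _
      rw [mul_sum, ee_sum]
    rw [this, norm_pow]; ring
  rw [sum_congr rfl (fun α _ => h3 α), orth_sq]
  congr 2
  refine card_bij (fun t _ => ![t.1 0, t.1 1, t.1 2, t.2 0, t.2 1, t.2 2]) ?_ ?_ ?_
  · intro t ht
    simp only [mem_filter, mem_product, Fintype.mem_piFinset] at ht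
    obtain ⟨⟨h1, h2⟩, h⟩ := ht
    simp only [mem_filter, Fintype.mem_piFinset]
    constructor
    · intro i; fin_cases i
      · exact h1 0
      · exact h1 1
      · exact h1 2
      · exact h2 0
      · exact h2 1
      · exact h2 2
    · simp only [Fin.sum_univ_six, Fin.sum_univ_three] at h ⊢
      simp
      linear_combination h
  · rintro ⟨t, t'⟩ _ ⟨w, w'⟩ _ h
    have g0 := congrFun h 0
    have g1 := congrFun h 1
    have g2 := congrFun h 2
    have g3 := congrFun h 3
    have g4 := congrFun h 4
    have g5 := congrFun h 5
    simp at g0 g1 g2 g3 g4 g5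
    simp only [Prod.mk.injEq]
    constructor <;> ext i <;> fin_cases i <;> simp [*]
  · intro t ht
    simp only [mem_filter, Fintype.mem_piFinset] at ht
    obtain ⟨h1, h⟩ := ht
    refine ⟨(![t 0, t 1, t 2], ![t 3, t 4, t 5]), ?_, ?_⟩
    · simp only [mem_filter, mem_product, Fintype.mem_piFinset]
      refine ⟨⟨?_, ?_⟩, ?_⟩
      · intro i; fin_cases i <;> simp only [] <;> exact h1 _
      · intro i; fin_cases i <;> simp only [] <;> exact h1 _
      · simp only [Fin.sum_univ_six, Fin.sum_univ_three] at h ⊢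
        simp at h ⊢
        linear_combination h
    · ext i; fin_cases i <;> simp

theorem sextic_total (p s : ℕ) [hp : Fact p.Prime] (hs : 0 < s) (V : ℕ) (hV : V ≤ p) (B : Finset (ZMod p)) :
    ∑ β ∈ B, ∑ α : ZMod p, ‖ff p s V α β‖ ^ 6 ≤ p * (729 * V ^ 3 * B.card + V ^ 6 * (6 + 6 * s)) := by
  have h := sextic_count p s hs V hV (![1, 1, 1, -1, -1, -1]) (by intro i; fin_cases i <;> simp) B
  simp only [sextic_one]
  rw [← mul_sum]
  gcongr
  exact_mod_cast h


def Q0 (p s : ℕ) (A : Finset (ZMod p)) (U : ℕ) : Finset ((ZMod p × ℕ) × (ZMod p × ℕ)) :=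
  ((A ×ˢ Icc 1 U) ×ˢ (A ×ˢ Icc 1 U)).filter
    (fun q => q.1.1 * (q.2.2 : ZMod p) ^ s = q.2.1 * (q.1.2 : ZMod p) ^ s)

theorem cast_ne (p U : ℕ) (hU : U < p) (u : ℕ) (hu : u ∈ Icc 1 U) : (u : ZMod p) ≠ 0 := by
  rw [mem_Icc] at hu
  intro h
  rw [ZMod.natCast_eq_zero_iff] at h
  have := Nat.le_of_dvd (by omega) h
  omega

theorem castU_inj (p U : ℕ) (hU : U < p) (u v : ℕ) (hu : u ∈ Icc 1 U) (hv : v ∈ Icc 1 U) (h : (u : ZMod p) = v) : u = v := by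
  rw [mem_Icc] at hu hv
  rw [ZMod.natCast_eq_natCast_iff', Nat.mod_eq_of_lt (by omega), Nat.mod_eq_of_lt (by omega)] at h
  exact h

theorem Q0_card1 (p s : ℕ) [hp : Fact p.Prime] (A : Finset (ZMod p)) (U : ℕ) (hU : U < p) :
    (Q0 p s A U).card ≤ A.card * U ^ 2 := by
  classical
  have : ((A ×ˢ Icc 1 U) ×ˢ Icc 1 U).card = A.card * U ^ 2 := by
    simp only [card_product, Nat.card_Icc]; simp; ring
  rw [← this]
  apply card_le_card_of_injOn (fun q => (q.1, q.2.2))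
  · intro q hq
    simp only [Q0, coe_filter, Set.mem_ofPred_eq, mem_product] at hq
    simp only [coe_product, Set.mem_prod, mem_coe]
    tauto
  · intro q hq q' hq' h
    simp only [Q0, coe_filter, Set.mem_ofPred_eq, mem_product] at hq hq'
    rcases q with ⟨⟨m, u⟩, m', u'⟩
    rcases q' with ⟨⟨n, v⟩, n', v'⟩
    simp only [Prod.mk.injEq] at h hq hq' ⊢
    obtain ⟨⟨rfl, rfl⟩, rfl⟩ := h
    have := cast_ne p U hU u hq.1.1.2
    refine ⟨⟨rfl, rfl⟩, ?_, rfl⟩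
    exact mul_right_cancel₀ (pow_ne_zero s this) (hq.2.symm.trans hq'.2)

theorem Q0_card2 (p s : ℕ) [hp : Fact p.Prime] (hs : 0 < s) (A : Finset (ZMod p)) (hA : ∀ m ∈ A, m ≠ 0)
    (U : ℕ) (hU : U < p) :
    (Q0 p s A U).card ≤ s * (A.card ^ 2 * U) := by
  classical
  have : ((A ×ˢ Icc 1 U) ×ˢ A).card = A.card^2 * U := by
    simp only [card_product, Nat.card_Icc]; simp; ring
  rw [← this]
  apply card_le_mul_card_image_of_maps_to (f := fun q => (q.1, q.2.1))
  · intro q hq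
    simp only [Q0, mem_filter, mem_product] at hq
    simp only [mem_product]
    tauto
  · rintro ⟨⟨m, u⟩, m'⟩ hy
    simp only [mem_product] at hy
    refine le_trans ?_ (roots_card p s hs (m' * (u : ZMod p)^s / m))
    apply card_le_card_of_injOn (fun q => (q.2.2 : ZMod p))
    · rintro ⟨⟨n, v⟩, n', v'⟩ hq
      simp only [Q0, coe_filter, Set.mem_ofPred_eq, mem_filter, mem_product, Prod.mk.injEq] at hq
      obtain ⟨⟨hq1, hq2⟩, ⟨rfl, rfl⟩, rfl⟩ := hq
      simp only [coe_filter, Set.mem_ofPred_eq, mem_univ, true_and]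
      rw [← hq2]
      have := hA n hy.1.1
      field_simp
    · rintro ⟨⟨n, v⟩, n', v'⟩ hq ⟨⟨k, w⟩, k', w'⟩ hq' h
      simp only [Q0, coe_filter, Set.mem_ofPred_eq, mem_filter, mem_product, Prod.mk.injEq] at hq hq' h ⊢
      have := castU_inj p U hU v' w' hq.1.1.2.2 hq'.1.1.2.2 h
      obtain ⟨⟨hq1, hq2⟩, ⟨rfl, rfl⟩, rfl⟩ := hq
      obtain ⟨⟨hq1', hq2'⟩, ⟨rfl, rfl⟩, rfl⟩ := hq'
      subst this
      simp

noncomputable def ZZ (p U : ℕ) (ρ : ZMod p) : Finset (ℤ × ℤ) :=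
  (Icc (-(U:ℤ)) U ×ˢ Icc (-(U:ℤ)) U).filter
          (fun t => (t.1 : ZMod p) ≠ 0 ∧ (t.2 : ZMod p) ≠ 0 ∧ (t.1 : ZMod p) = ρ * t.2)

theorem ZZ_sum (p s : ℕ) [hp : Fact p.Prime] (A : Finset (ZMod p)) 
    (U : ℕ) (hU : U < p) (hU2 : 2 * U ^ 2 < p) (D : ℝ) (hD : DivB p D) :
    ∑ q ∈ Q0 p s A U, ((ZZ p U ((q.1.2 : ZMod p) / q.2.2)).card : ℝ) ≤ 3 * D * A.card * U ^ 2 := by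
  classical
  set R := (Q0 p s A U).sigma (fun q => ZZ p U ((q.1.2 : ZMod p) / q.2.2)) with hR
  have e1 : ∑ q ∈ Q0 p s A U, ((ZZ p U ((q.1.2 : ZMod p) / q.2.2)).card : ℝ) = (R.card : ℝ) := by
    rw [hR, card_sigma]; push_cast; rfl
  set G : ((_ : (ZMod p × ℕ) × (ZMod p × ℕ)) × (ℤ × ℤ)) → ZMod p × (ℕ × ℤ) :=
    fun w => (w.1.1.1, (w.1.1.2, w.2.2)) with hG
  set Y := A ×ˢ (Icc 1 U ×ˢ Icc (-(U:ℤ)) U) with hY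
  have key : ∀ w ∈ R, w.1.1.1 ∈ A ∧ w.1.1.2 ∈ Icc 1 U ∧ w.1.2.2 ∈ Icc 1 U ∧ w.2.1 ∈ Icc (-(U:ℤ)) U ∧ w.2.2 ∈ Icc (-(U:ℤ)) U ∧
      w.2.2 ≠ 0 ∧ w.2.1 * (w.1.2.2:ℤ) = (w.1.1.2 : ℤ) * w.2.2 ∧ w.1.1.1 * (w.1.2.2 : ZMod p)^s = w.1.2.1 * (w.1.1.2 : ZMod p)^s := by
    rintro ⟨⟨⟨m, u⟩, m', u'⟩, w, w'⟩ hw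
    simp only [hR, mem_sigma, Q0, ZZ, mem_filter, mem_product] at hw ⊢
    obtain ⟨⟨⟨⟨h1, h2⟩, h3, h4⟩, h5⟩, ⟨h6, h7⟩, h8, h9, h10⟩ := hw
    refine ⟨h1, h2, h4, h6, h7, ?_, ?_, h5⟩
    · rintro rfl; simp at h9
    · have hu := cast_ne p U hU u h2
      have hu' := cast_ne p U hU u' h4
      have : ((w * (u':ℤ) - (u:ℤ) * w' : ℤ) : ZMod p) = 0 := by
        push_cast; rw [h10]; field_simp; ring
      rw [ZMod.intCast_zmod_eq_zero_iff_dvd] at this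
      have h0 := Int.eq_zero_of_abs_lt_dvd this ?_
      · linarith
      · simp only [mem_Icc] at h2 h4 h6 h7
        have a1 : |w| ≤ U := abs_le.mpr h6
        have a2 : |w'| ≤ U := abs_le.mpr h7
        have b1 : (u:ℤ) ≤ U := by exact_mod_cast h2.2
        have b2 : (u':ℤ) ≤ U := by exact_mod_cast h4.2
        calc |w * (u':ℤ) - (u:ℤ) * w'| ≤ |w * (u':ℤ)| + |(u:ℤ) * w'| := abs_sub _ _
          _ = |w| * u' + u * |w'| := by rw [abs_mul, abs_mul]; simp
          _ ≤ U * U + U * U := by gcongr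
          _ < p := by have : ((2 * U^2 : ℕ):ℤ) < p := by exact_mod_cast hU2
                      push_cast at this; linarith
  have hmaps : ∀ w ∈ R, G w ∈ Y := by
    intro w hw
    have := key w hw
    simp only [hY, hG, mem_product]; tauto
  have hfib : ∀ y ∈ Y, ((R.filter (fun w => G w = y)).card : ℝ) ≤ D := by
    rintro ⟨m, u, w'⟩ hy
    simp only [hY, mem_product] at hy
    by_cases hw0 : w' = 0
    · have : R.filter (fun w => G w = (m, u, w')) = ∅ := by
        apply filter_eq_empty_iff.mpr
        intro w hw h
        have := (key w hw).2.2.2.2.2.1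
        simp only [hG, Prod.mk.injEq] at h
        exact this (h.2.2.trans hw0)
      rw [this]; simp; linarith [hD.1]
    · have hu0 : (u:ℤ) ≠ 0 := by
        have := (mem_Icc.mp hy.2.1).1; omega
      refine le_trans ?_ (hD.2 U hU ((u:ℤ) * w') (mul_ne_zero hu0 hw0))
      rw [Nat.cast_le]
      apply card_le_card_of_injOn (fun w => (w.2.1, (w.1.2.2 : ℤ)))
      · intro w hw
        simp only [coe_filter, Set.mem_ofPred_eq] at hw
        obtain ⟨hw, hGw⟩ := hw
        obtain ⟨k1, k2, k3, k4, k5, k6, k7, k8⟩ := key w hw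
        simp only [hG, Prod.mk.injEq] at hGw
        obtain ⟨g1, g2, g3⟩ := hGw
        simp only [coe_filter, Set.mem_ofPred_eq, mem_product]
        rw [← g2, ← g3]
        refine ⟨⟨k4, ?_⟩, k7⟩
        simp only [mem_Icc] at k3 ⊢
        omega
      · intro w hw x hx h
        simp only [coe_filter, Set.mem_ofPred_eq] at hw hx
        obtain ⟨hw, hGw⟩ := hw
        obtain ⟨hx, hGx⟩ := hx
        obtain ⟨k1, k2, k3, k4, k5, k6, k7, k8⟩ := key w hw
        obtain ⟨l1, l2, l3, l4, l5, l6, l7, l8⟩ := key x hx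
        have hGG := hGw.trans hGx.symm
        rcases w with ⟨⟨⟨n, v⟩, n', v'⟩, a, a'⟩
        rcases x with ⟨⟨⟨k, w⟩, k', w'⟩, b, b'⟩
        simp only [hG, Prod.mk.injEq, Nat.cast_inj] at hGG h
        obtain ⟨rfl, rfl, rfl⟩ := hGG
        obtain ⟨rfl, rfl⟩ := h
        have := mul_right_cancel₀ (pow_ne_zero s (cast_ne p U hU v k2)) (k8.symm.trans l8)
        simp only at this
        subst this
        rfl
  rw [e1, card_eq_sum_card_fiberwise (f := G) (t := Y) hmaps]
  push_cast
  calc _ ≤ ∑ y ∈ Y, D := sum_le_sum hfib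
    _ = Y.card * D := by rw [sum_const, nsmul_eq_mul]
    _ = (A.card * (U * (2 * U + 1))) * D := by
        rw [hY, card_product, card_product, Nat.card_Icc, Int.card_Icc]
        have : ((U:ℤ) + 1 - -(U:ℤ)).toNat = 2 * U + 1 := by omega
        rw [this]; push_cast; simp
    _ ≤ _ := by
        have hD0 := hD.1
        rcases Nat.eq_zero_or_pos U with h | h
        · subst h; simp
        · have hU1 : (1:ℝ) ≤ U := by exact_mod_cast h
          calc (A.card * (U * (2 * U + 1))) * D ≤ (A.card * (U * (2 * U + U))) * D := by gcongr
            _ = _ := by ring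


theorem hold6 {ι κ : Type*} [DecidableEq κ] (T : Finset ι) (φ : ι → κ) (g : κ → ℝ) (hg : ∀ y, 0 ≤ g y) :
    (∑ t ∈ T, g (φ t)) ^ 6 ≤ (T.card : ℝ) ^ 4 * ((T ×ˢ T).filter (fun w => φ w.1 = φ w.2)).card *
      ∑ y ∈ T.image φ, g y ^ 6 := by
  set Y := T.image φ with hY
  set n : κ → ℕ := fun y => (T.filter (fun t => φ t = y)).card with hn
  have h1 : (∑ t ∈ T, g (φ t)) ^ 3 ≤ (T.card : ℝ) ^ 2 * ∑ t ∈ T, g (φ t) ^ 3 :=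
    pow_sum_le_card_mul_sum_pow (fun t _ => hg _) 2
  have h2 : ∑ t ∈ T, g (φ t) ^ 3 = ∑ y ∈ Y, (n y : ℝ) * g y ^ 3 := by
    rw [← sum_fiberwise_of_maps_to (s := T) (t := Y) (g := φ) (fun t ht => mem_image_of_mem _ ht)]
    apply sum_congr rfl
    intro y _
    rw [sum_congr rfl (g := fun _ => g y ^ 3), sum_const, nsmul_eq_mul]
    intro t ht
    rw [(mem_filter.mp ht).2]
  have h3 : (∑ y ∈ Y, (n y : ℝ) * g y ^ 3) ^ 2 ≤ (∑ y ∈ Y, (n y : ℝ) ^ 2) * ∑ y ∈ Y, (g y ^ 3) ^ 2 :=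
    sum_mul_sq_le_sq_mul_sq _ _ _
  have h4 : ∑ y ∈ Y, (n y) ^ 2 = ((T ×ˢ T).filter (fun w => φ w.1 = φ w.2)).card := by
    rw [card_eq_sum_card_fiberwise (f := fun w => φ w.1) (t := Y)]
    · apply sum_congr rfl
      intro y _
      rw [hn, sq, ← card_product]
      congr 1
      ext ⟨a, b⟩
      simp only [mem_product, mem_filter]
      constructor
      · rintro ⟨⟨h1, h2⟩, h3, h4⟩; exact ⟨⟨⟨h1, h3⟩, h2.trans h4.symm⟩, h2⟩
      · rintro ⟨⟨⟨h1, h2⟩, h3⟩, h4⟩; exact ⟨⟨h1, h4⟩, h2, h3.symm.trans h4⟩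
    · intro w hw
      simp only [coe_filter, Set.mem_ofPred_eq, mem_product] at hw
      exact mem_image_of_mem _ hw.1.1
  have h0 : 0 ≤ ∑ t ∈ T, g (φ t) := sum_nonneg (fun t _ => hg _)
  have h5 : ∑ y ∈ Y, (g y ^ 3) ^ 2 = ∑ y ∈ Y, g y ^ 6 := by
    apply sum_congr rfl; intro y _; ring
  calc (∑ t ∈ T, g (φ t)) ^ 6 = ((∑ t ∈ T, g (φ t)) ^ 3) ^ 2 := by ring
    _ ≤ ((T.card : ℝ) ^ 2 * ∑ t ∈ T, g (φ t) ^ 3) ^ 2 := by gcongr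
    _ = (T.card : ℝ) ^ 4 * (∑ y ∈ Y, (n y : ℝ) * g y ^ 3) ^ 2 := by rw [h2]; ring
    _ ≤ (T.card : ℝ) ^ 4 * ((∑ y ∈ Y, (n y : ℝ) ^ 2) * ∑ y ∈ Y, (g y ^ 3) ^ 2) := by gcongr
    _ = _ := by
      rw [h5, ← h4]; push_cast; ring

noncomputable def TT (p : ℕ) (A : Finset (ZMod p)) (U : ℕ) (L : ℤ) (H : ℕ) : Finset ((ZMod p × ℕ) × ℤ) :=
  (A ×ˢ Icc 1 U) ×ˢ Ico L (L + H)

noncomputable def ph (p s : ℕ) (t : (ZMod p × ℕ) × ℤ) : ZMod p × ZMod p :=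
  (t.1.1 * ((t.1.2 : ZMod p) ^ s)⁻¹, (t.2 : ZMod p) * (t.1.2 : ZMod p)⁻¹)

theorem W_bound (p s : ℕ) [hp : Fact p.Prime] (hs : 0 < s) (A : Finset (ZMod p)) (hA : ∀ m ∈ A, m ≠ 0)
    (U : ℕ) (hU1 : 1 ≤ U) (hU2 : 2 * U ^ 2 < p) (D : ℝ) (hD : DivB p D) (L : ℤ) (H : ℕ) (hUH : U ≤ H)
    (hc : H * U ≤ p ∨ H * A.card ≤ p) :
    ((((TT p A U L H) ×ˢ (TT p A U L H)).filter (fun w => ph p s w.1 = ph p s w.2)).card : ℝ) ≤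
      36 * s * D * (A.card * H * U) := by
  classical
  have hU : U < p := by nlinarith
  set W := ((TT p A U L H) ×ˢ (TT p A U L H)).filter (fun w => ph p s w.1 = ph p s w.2) with hW
  have e1 : W.card ≤ ∑ q ∈ Q0 p s A U, NN p ((q.1.2 : ZMod p) / q.2.2) (Ico L (L+H)) (Ico L (L+H)) := by
    unfold NN
    rw [← card_sigma]
    apply card_le_card_of_injOn (fun w => (⟨(w.1.1, w.2.1), (w.1.2, w.2.2)⟩ : (_ : (ZMod p × ℕ) × (ZMod p × ℕ)) × (ℤ × ℤ)))
    · intro w hw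
      simp only [hW, TT, ph, coe_filter, Set.mem_ofPred_eq, mem_product, Prod.mk.injEq] at hw
      obtain ⟨⟨⟨⟨h1, h2⟩, h3⟩, ⟨h4, h5⟩, h6⟩, h7, h8⟩ := hw
      have g1 := cast_ne p U hU _ h2
      have g2 := cast_ne p U hU _ h5
      simp only [coe_sigma, Set.mem_sigma_iff, mem_coe, Q0, mem_filter, mem_product]
      field_simp at h7 h8
      refine ⟨⟨⟨⟨h1, h2⟩, h4, h5⟩, by linear_combination h7⟩, ⟨h3, h6⟩, ?_⟩
      field_simp
      linear_combination h8
    · rintro ⟨⟨a, b⟩, c, d⟩ _ ⟨⟨a', b'⟩, c', d'⟩ _ h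
      simp only [Sigma.mk.injEq, Prod.mk.injEq, heq_eq_eq] at h ⊢
      tauto
  have e2 : ∀ q ∈ Q0 p s A U, (NN p ((q.1.2 : ZMod p) / q.2.2) (Ico L (L+H)) (Ico L (L+H)) : ℝ) ≤
      6 * (1 + (H:ℝ)^2 / p + (H:ℝ) / U * (1 + (ZZ p U ((q.1.2 : ZMod p) / q.2.2)).card)) := by
    intro q hq
    simp only [Q0, mem_filter, mem_product] at hq
    exact lattice_real p _ (div_ne_zero (cast_ne p U hU _ hq.1.1.2) (cast_ne p U hU _ hq.1.2.2)) U hU1 hU L L H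
  have e3 := ZZ_sum p s A U hU hU2 D hD
  have c1 : ((Q0 p s A U).card : ℝ) ≤ A.card * U ^ 2 := by exact_mod_cast Q0_card1 p s A U hU
  have c2 : ((Q0 p s A U).card : ℝ) ≤ s * (A.card ^ 2 * U) := by exact_mod_cast Q0_card2 p s hs A hA U hU
  set Z : ℝ := ∑ q ∈ Q0 p s A U, ((ZZ p U ((q.1.2 : ZMod p) / q.2.2)).card : ℝ) with hZ
  set Q : ℝ := ((Q0 p s A U).card : ℝ) with hQ
  have hQ0 : 0 ≤ Q := by positivity
  have hUr : (1:ℝ) ≤ U := by exact_mod_cast hU1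
  have hUHr : (U:ℝ) ≤ H := by exact_mod_cast hUH
  have hs1 : (1:ℝ) ≤ s := by exact_mod_cast hs
  have hp0 : (0:ℝ) < p := by exact_mod_cast hp.out.pos
  have hM0 : (0:ℝ) ≤ A.card := by positivity
  have e4 : (W.card : ℝ) ≤ Q * (6 * (1 + (H:ℝ)^2 / p + (H:ℝ) / U)) + 6 * ((H:ℝ)/U) * Z := by
    calc (W.card : ℝ) ≤ ∑ q ∈ Q0 p s A U, (NN p ((q.1.2 : ZMod p) / q.2.2) (Ico L (L+H)) (Ico L (L+H)) : ℝ) := by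
          exact_mod_cast e1
      _ ≤ ∑ q ∈ Q0 p s A U, (6 * (1 + (H:ℝ)^2 / p + (H:ℝ) / U) + 6 * ((H:ℝ) / U) * (ZZ p U ((q.1.2 : ZMod p) / q.2.2)).card) := by
          apply sum_le_sum; intro q hq
          refine (e2 q hq).trans (le_of_eq (by ring))
      _ = _ := by rw [sum_add_distrib, sum_const, ← mul_sum, nsmul_eq_mul]
  have hcr : (H:ℝ) * U ≤ p ∨ (H:ℝ) * A.card ≤ p := by exact_mod_cast hc
  clear_value Z Q
  generalize (A.card : ℝ) = M at *
  have hM' : 0 ≤ M := hM0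
  have f1 : Q * ((H:ℝ) / U) ≤ M * H * U := by
    calc Q * ((H:ℝ) / U) ≤ (M * U^2) * ((H:ℝ)/U) := by gcongr
      _ = _ := by field_simp
  have f2 : Q * 1 ≤ M * H * U := by
    refine le_trans ?_ f1
    gcongr
    rw [le_div_iff₀ (by linarith)]; linarith
  have f3 : Q * ((H:ℝ)^2 / p) ≤ s * (M * H * U) := by
    rcases hcr with hc' | hc'
    · calc Q * ((H:ℝ)^2 / p) ≤ (M * U^2) * ((H:ℝ)^2 / p) := by gcongr
        _ = (M * H * U) * ((H * U) / p) := by ring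
        _ ≤ (M * H * U) * 1 := by
            gcongr; rw [div_le_one hp0]; exact hc'
        _ ≤ (M * H * U) * s := by gcongr
        _ = _ := by ring
    · calc Q * ((H:ℝ)^2 / p) ≤ (s * (M^2 * U)) * ((H:ℝ)^2 / p) := by gcongr
        _ = s * (M * H * U) * ((H * M) / p) := by ring
        _ ≤ s * (M * H * U) * 1 := by
            gcongr; rw [div_le_one hp0]; exact hc'
        _ = _ := by ring
  have f4 : ((H:ℝ)/U) * Z ≤ 3 * D * (M * H * U) := by
    calc ((H:ℝ)/U) * Z ≤ ((H:ℝ)/U) * (3 * D * M * U^2) := by gcongr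
      _ = _ := by field_simp
  have hD1 := hD.1
  have hMHU : 0 ≤ M * H * U := by positivity
  have f5 : (W.card : ℝ) ≤ (12 + 6 * s + 18 * D) * (M * H * U) := by nlinarith
  refine f5.trans ?_
  gcongr
  nlinarith

theorem SS_eq_shift (p s : ℕ) [NeZero p] (A : Finset (ZMod p)) (L : ℤ) (k H : ℕ) :
    SS p s A (L + k) H = ∑ t ∈ A ×ˢ Ico L (L + H), ee p (t.1 * ((((t.2 : ℤ) : ZMod p) + (k : ZMod p)) ^ s)⁻¹) := by
  unfold SS
  rw [sum_product]
  apply sum_congr rfl; intro m _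
  refine sum_bij (fun j _ => L + (j:ℤ)) ?_ ?_ ?_ ?_
  · intro j hj; simp only [mem_range] at hj; simp only [mem_Ico]; constructor <;> omega
  · intro a _ b _ h; simpa using h
  · intro x hx; simp only [mem_Ico] at hx
    refine ⟨(x - L).toNat, ?_, ?_⟩
    · simp only [mem_range]; omega
    · omega
  · intro j _; push_cast; congr 4; ring

theorem dbl_sum (p s : ℕ) [hp : Fact p.Prime] (A : Finset (ZMod p)) (U V : ℕ) (hU : U < p) (L : ℤ) (H : ℕ) :
    ∑ u ∈ Icc 1 U, ∑ v ∈ range V, SS p s A (L + ((u * v : ℕ) : ℤ)) H =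
      ∑ t ∈ TT p A U L H, ff p s V (ph p s t).1 (ph p s t).2 := by
  unfold TT
  rw [sum_product, sum_product, sum_comm (s := A)]
  apply sum_congr rfl
  intro u hu
  have hu0 := cast_ne p U hU u hu
  simp only [SS_eq_shift, ff, ph]
  rw [sum_comm, sum_product]
  apply sum_congr rfl; intro m _
  apply sum_congr rfl; intro x _
  apply sum_congr rfl; intro v _
  congr 1
  rw [mul_assoc, ← mul_inv, ← mul_pow]
  congr 3
  push_cast
  field_simp

theorem avg_bound (p s : ℕ) [hp : Fact p.Prime] (hs : 0 < s) (A : Finset (ZMod p)) (hA : ∀ m ∈ A, m ≠ 0)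
    (U V : ℕ) (hU1 : 1 ≤ U) (hU2 : 2 * U ^ 2 < p) (hV : V ≤ p) (D : ℝ) (hD : DivB p D) (L : ℤ) (H : ℕ) (hUH : U ≤ H)
    (hc : H * U ≤ p ∨ H * A.card ≤ p) (hB : H * U ≤ 64 * V ^ 3 ∨ p ≤ 64 * V ^ 3) :
    ‖∑ u ∈ Icc 1 U, ∑ v ∈ range V, SS p s A (L + ((u * v : ℕ) : ℤ)) H‖ ^ 6 ≤
      2000000 * s ^ 2 * D * p * (A.card * H : ℝ) ^ 5 * U ^ 5 * V ^ 6 := by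
  classical
  have hU : U < p := by nlinarith
  rw [dbl_sum p s A U V hU L H]
  have h1 : ‖∑ t ∈ TT p A U L H, ff p s V (ph p s t).1 (ph p s t).2‖ ≤
      ∑ t ∈ TT p A U L H, ‖ff p s V (ph p s t).1 (ph p s t).2‖ := norm_sum_le _ _
  have h2 := hold6 (TT p A U L H) (ph p s) (fun y => ‖ff p s V y.1 y.2‖) (fun y => norm_nonneg _)
  have h3 := W_bound p s hs A hA U hU1 hU2 D hD L H hUH hc
  have hTc : (TT p A U L H).card = A.card * H * U := by
    unfold TT; simp; ring
  set Y := (TT p A U L H).image (ph p s) with hY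
  set B := (TT p A U L H).image (fun t => (ph p s t).2) with hBdef
  have h4 : ∑ y ∈ Y, ‖ff p s V y.1 y.2‖ ^ 6 ≤ ∑ β ∈ B, ∑ α : ZMod p, ‖ff p s V α β‖ ^ 6 := by
    rw [← sum_product_right' (s := univ) (t := B) (f := fun α β => ‖ff p s V α β‖ ^ 6)]
    apply sum_le_sum_of_subset_of_nonneg
    · intro y hy
      simp only [hY, mem_image] at hy
      obtain ⟨t, ht, rfl⟩ := hy
      rw [mem_product]
      exact ⟨mem_univ _, mem_image_of_mem (fun t => (ph p s t).2) ht⟩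
    · intro y _ _; positivity
  have h5 := sextic_total p s hs V hV B
  have hBc : B.card ≤ 64 * V^3 := by
    rcases hB with hB | hB
    · refine le_trans ?_ hB
      have : B ⊆ (Icc 1 U ×ˢ Ico L (L+H)).image (fun w => ((w.2 : ℤ) : ZMod p) * (w.1 : ZMod p)⁻¹) := by
        intro b hb
        simp only [hBdef, mem_image] at hb
        obtain ⟨t, ht, rfl⟩ := hb
        rw [mem_image]
        simp only [TT, mem_product] at ht
        exact ⟨(t.1.2, t.2), mem_product.mpr ⟨ht.1.2, ht.2⟩, rfl⟩
      refine (card_le_card this).trans (card_image_le.trans ?_)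
      simp; rw [mul_comm]
    · refine le_trans ?_ hB
      refine (card_le_univ B).trans ?_
      rw [ZMod.card]
  have hBr : (B.card : ℝ) ≤ 64 * V^3 := by exact_mod_cast hBc
  have hs1 : (1:ℝ) ≤ s := by exact_mod_cast hs
  have hD1 := hD.1
  have h6 : ∑ y ∈ Y, ‖ff p s V y.1 y.2‖ ^ 6 ≤ p * (50000 * s * V^6) := by
    refine h4.trans (h5.trans ?_)
    gcongr
    calc (729:ℝ) * (V:ℝ)^3 * B.card + (V:ℝ)^6 * (6 + 6 * (s:ℝ)) ≤ 729 * (V:ℝ)^3 * (64 * V^3) + (V:ℝ)^6 * (6 + 6 * (s:ℝ)) := by gcongr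
      _ = (46656 + 6 + 6 * (s:ℝ)) * (V:ℝ)^6 := by ring
      _ ≤ _ := by gcongr; linarith
  calc _ ≤ (∑ t ∈ TT p A U L H, ‖ff p s V (ph p s t).1 (ph p s t).2‖) ^ 6 := by gcongr
    _ ≤ _ := h2
    _ ≤ ((A.card * H * U : ℝ))^4 * (36 * s * D * (A.card * H * U)) * (p * (50000 * s * V^6)) := by
        rw [hTc]
        push_cast
        gcongr
    _ = 1800000 * s^2 * D * p * (A.card * H : ℝ) ^ 5 * U ^ 5 * V ^ 6 := by ring
    _ ≤ _ := by gcongr; norm_num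

theorem step_bound (p s : ℕ) [hp : Fact p.Prime] (hs : 0 < s) (A : Finset (ZMod p)) (hA : ∀ m ∈ A, m ≠ 0)
    (U V : ℕ) (hU1 : 1 ≤ U) (hU2 : 2 * U ^ 2 < p) (hV1 : 1 ≤ V) (hV : V ≤ p) (D : ℝ) (hD : DivB p D) (L : ℤ) (H : ℕ) (hUH : U ≤ H)
    (hc : H * U ≤ p ∨ H * A.card ≤ p) (hB : H * U ≤ 64 * V ^ 3 ∨ p ≤ 64 * V ^ 3)
    (Bd R : ℝ) (hBd : ∀ L' : ℤ, ∀ t : ℕ, t ≤ U * V → ‖SS p s A L' t‖ ≤ Bd) (hR : 0 ≤ R)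
    (hR6 : 2000000 * s ^ 2 * D * p * (A.card * H : ℝ) ^ 5 ≤ R ^ 6 * U) :
    ‖SS p s A L H‖ ≤ 2 * Bd + R := by
  have h1 := avg_bound p s hs A hA U V hU1 hU2 hV D hD L H hUH hc hB
  set Sg := ∑ u ∈ Icc 1 U, ∑ v ∈ range V, SS p s A (L + ((u * v : ℕ) : ℤ)) H with hSg
  have hUr : (1:ℝ) ≤ U := by exact_mod_cast hU1
  have hVr : (1:ℝ) ≤ V := by exact_mod_cast hV1
  have h2 : ‖Sg‖ ≤ U * V * R := by
    apply le_of_pow_le_pow_left₀ (n := 6) (by norm_num) (by positivity)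
    refine h1.trans ?_
    calc 2000000 * s ^ 2 * D * p * (A.card * H : ℝ) ^ 5 * U ^ 5 * V ^ 6
        = (2000000 * s ^ 2 * D * p * (A.card * H : ℝ) ^ 5) * (U ^ 5 * V ^ 6) := by ring
      _ ≤ (R^6 * U) * (U^5 * V^6) := by gcongr
      _ = _ := by ring
  have h3 : (U * V : ℂ) * SS p s A L H - Sg = ∑ u ∈ Icc 1 U, ∑ v ∈ range V,
      (SS p s A L (u * v) - SS p s A (L + H) (u * v)) := by
    have : (U * V : ℂ) * SS p s A L H = ∑ u ∈ Icc 1 U, ∑ v ∈ range V, SS p s A L H := by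
      simp; ring
    rw [this, hSg, ← sum_sub_distrib]
    apply sum_congr rfl; intro u _
    rw [← sum_sub_distrib]
    apply sum_congr rfl; intro v _
    rw [SS_shift p s A L H (u * v)]; ring
  have h4 : ‖(U * V : ℂ) * SS p s A L H - Sg‖ ≤ U * V * (2 * Bd) := by
    rw [h3]
    refine (norm_sum_le _ _).trans ?_
    calc _ ≤ ∑ u ∈ Icc 1 U, ∑ v ∈ range V, (2 * Bd) := by
          apply sum_le_sum; intro u hu
          refine (norm_sum_le _ _).trans ?_
          apply sum_le_sum; intro v hv
          rw [mem_Icc] at hu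
          rw [mem_range] at hv
          have huv : u * v ≤ U * V := Nat.mul_le_mul hu.2 hv.le
          refine (norm_sub_le _ _).trans ?_
          linarith [hBd L _ huv, hBd (L + H) _ huv]
      _ = _ := by simp; ring
  have h5 : (U * V : ℝ) * ‖SS p s A L H‖ ≤ (U * V : ℝ) * (2 * Bd + R) := by
    have : ‖(U * V : ℂ) * SS p s A L H‖ = (U * V : ℝ) * ‖SS p s A L H‖ := by simp
    rw [← this]
    calc _ = ‖((U * V : ℂ) * SS p s A L H - Sg) + Sg‖ := by simp
      _ ≤ _ := norm_add_le _ _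
      _ ≤ U * V * (2 * Bd) + U * V * R := add_le_add h4 h2
      _ = _ := by ring
  exact le_of_mul_le_mul_left h5 (by positivity)


theorem exists_root (n : ℕ) (hn : n ≠ 0) (x : ℝ) (hx : 0 ≤ x) : ∃ y : ℝ, 0 ≤ y ∧ y ^ n = x :=
  ⟨x ^ ((n:ℝ)⁻¹), by positivity, Real.rpow_inv_natCast_pow hx hn⟩

theorem K_bound (s D : ℝ) (hs : 1 ≤ s) (hD : 1 ≤ D) :
    125000 * (2000000 * s ^ 2 * D) ≤ (100 * s * D) ^ 6 := by
  have h1 : s^2 * D ≤ s^6 * D^6 := by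
    have a : s^2 ≤ s^6 := pow_le_pow_right₀ hs (by norm_num)
    have b : D ≤ D^6 := le_self_pow₀ hD (by norm_num)
    gcongr
  calc 125000 * (2000000 * s ^ 2 * D) = 250000000000 * (s^2 * D) := by ring
    _ ≤ 1000000000000 * (s^6 * D^6) := by
        have : 0 ≤ s^2 * D := by positivity
        nlinarith
    _ = _ := by ring

theorem case_one (p s : ℕ) [hp : Fact p.Prime] (hs : 0 < s) (A : Finset (ZMod p)) (hA : ∀ m ∈ A, m ≠ 0)
    (D : ℝ) (hD : DivB p D) (Q : ℝ) (hQ : 0 ≤ Q) (hQ6 : Q ^ 6 = (100 * s * D) ^ 6 * p * (A.card:ℝ) ^ 5) :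
    ∀ H : ℕ, H ^ 3 ≤ p ^ 2 → ∀ L : ℤ, ∀ h : ℝ, 0 ≤ h → h ^ 4 = H → ‖SS p s A L H‖ ≤ Q * h ^ 3 := by
  intro H
  induction H using Nat.strong_induction_on with
  | _ H ih =>
  intro hH L h hh hh4
  have hs1 : (1:ℝ) ≤ s := by exact_mod_cast hs
  have hD1 := hD.1
  have hK := K_bound s D hs1 hD1
  have hM : A.card ≤ p := by
    refine (card_le_univ A).trans ?_; rw [ZMod.card]
  have hMr : (A.card : ℝ) ≤ p := by exact_mod_cast hM
  by_cases h16 : H < 16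
  · refine (SS_trivial p s A L H).trans ?_
    have hK2 : 2 ≤ 100 * s * D := by nlinarith
    have h2M : 2 * (A.card:ℝ) ≤ Q := by
      apply le_of_pow_le_pow_left₀ (n := 6) (by norm_num) hQ
      rw [hQ6]
      calc (2 * (A.card:ℝ)) ^ 6 = 2^6 * A.card * (A.card:ℝ)^5 := by ring
        _ ≤ (100 * s * D)^6 * p * (A.card:ℝ)^5 := by gcongr
    have hh2 : h ≤ 2 := by
      apply le_of_pow_le_pow_left₀ (n := 4) (by norm_num) (by norm_num)
      rw [hh4]
      have : (H:ℝ) ≤ 16 := by exact_mod_cast h16.le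
      linarith
    rw [← hh4]
    calc (A.card:ℝ) * h^4 = (A.card * h) * h^3 := by ring
      _ ≤ (A.card * 2) * h^3 := by gcongr
      _ ≤ Q * h^3 := by gcongr; linarith
  · push Not at h16
    set r := Nat.sqrt H with hr
    have hr1 : r * r ≤ H := Nat.sqrt_le H
    have hr2 : H < (r+1) * (r+1) := Nat.lt_succ_sqrt H
    have hr4 : 4 ≤ r := by
      rw [hr, Nat.le_sqrt]; omega
    set U := r / 4 with hU
    have hU1 : 1 ≤ U := by omega
    have hU4 : 4 * U ≤ r := by omega
    have hU8 : r + 1 ≤ 8 * U := by omega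
    have hHp : H ≤ p := by
      have : H^3 ≤ p^3 := hH.trans (Nat.pow_le_pow_right hp.out.pos (by norm_num))
      exact (Nat.pow_le_pow_iff_left (by norm_num)).mp this
    have hUU : 16 * U^2 ≤ H := by nlinarith
    have hUV : 4 * (U * r) ≤ H := by nlinarith
    obtain ⟨τ, hτ, hτ4⟩ := exists_root 4 (by norm_num) ((U * r : ℕ):ℝ) (by positivity)
    have hb := step_bound p s hs A hA U r hU1 (by omega) (by omega) (by nlinarith) D hD L H (by nlinarith)
      (Or.inl (by
        have : (H * U)^2 ≤ p^2 := by
          calc (H*U)^2 = H^2 * U^2 := by ring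
            _ ≤ H^2 * H := by gcongr; omega
            _ = H^3 := by ring
            _ ≤ p^2 := hH
        exact (Nat.pow_le_pow_iff_left (by norm_num)).mp this))
      (Or.inl (by
        have : H ≤ 4 * r^2 := by nlinarith
        have hUr : U ≤ r := by omega
        calc H * U ≤ 4 * r^2 * r := by gcongr
          _ ≤ 64 * r^3 := by nlinarith [pow_pos (by omega : 0 < r) 3]))
      (Q * τ^3) (Q * h^3 / 4) ?_ (by positivity) ?_
    · refine hb.trans ?_
      have : 2 * τ^3 ≤ 3/4 * h^3 := by
        apply le_of_pow_le_pow_left₀ (n := 4) (by norm_num) (by positivity)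
        have h1 : 4 * τ^4 ≤ h^4 := by rw [hτ4, hh4]; exact_mod_cast hUV
        calc (2 * τ^3)^4 = (4 * τ^4)^3 / 4 := by ring
          _ ≤ (h^4)^3 / 4 := by gcongr
          _ ≤ (3/4 * h^3)^4 := by
            have : 0 ≤ h^12 := by positivity
            nlinarith
      nlinarith
    · intro L' t ht
      obtain ⟨θ, hθ, hθ4⟩ := exists_root 4 (by norm_num) (t:ℝ) (by positivity)
      have htH : t < H := by
        have : 0 < U * r := by positivity
        omega
      refine (ih t htH (le_trans (Nat.pow_le_pow_left htH.le 3) hH) L' θ hθ hθ4).trans ?_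
      have : θ ≤ τ := by
        apply le_of_pow_le_pow_left₀ (n := 4) (by norm_num) hτ
        rw [hθ4, hτ4]; exact_mod_cast ht
      gcongr
    · have hU' : h^2 ≤ 8 * U := by
        apply le_of_pow_le_pow_left₀ (n := 2) (by norm_num) (by positivity)
        have h1 : H ≤ (8 * U)^2 := by nlinarith
        calc (h^2)^2 = h^4 := by ring
          _ = (H:ℝ) := hh4
          _ ≤ (8 * (U:ℝ))^2 := by exact_mod_cast h1
      calc 2000000 * s ^ 2 * D * p * (A.card * H : ℝ) ^ 5
          = (125000 * (2000000 * s ^ 2 * D)) * p * (A.card:ℝ)^5 * h^20 / 125000 := by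
            rw [← hh4]; ring
        _ ≤ (100 * s * D)^6 * p * (A.card:ℝ)^5 * h^20 / 125000 := by gcongr
        _ = Q^6 * h^18 * h^2 / 125000 := by rw [hQ6]; ring
        _ ≤ Q^6 * h^18 * (8 * U) / 125000 := by gcongr
        _ ≤ (Q * h^3 / 4)^6 * U := by
            have : 0 ≤ Q^6 * h^18 * U := by positivity
            have e : (Q * h^3 / 4)^6 * U = Q^6 * h^18 * U / 4096 := by ring
            rw [e]; linarith

theorem case_two (p s : ℕ) [hp : Fact p.Prime] (hs : 0 < s) (A : Finset (ZMod p)) (hA : ∀ m ∈ A, m ≠ 0)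
    (D : ℝ) (hD : DivB p D) (Q pi : ℝ) (hQ : 0 ≤ Q) (hpi : 0 ≤ pi) (hpi3 : pi ^ 3 = p)
    (hQ6 : Q ^ 6 = (100 * s * D) ^ 6 * (p * pi) * (A.card:ℝ) ^ 5) :
    ∀ H : ℕ, H ^ 6 ≤ p ^ 5 → H * A.card ≤ p → ∀ L : ℤ, ∀ g : ℝ, 0 ≤ g → g ^ 3 = H → ‖SS p s A L H‖ ≤ Q * g ^ 2 := by
  intro H
  induction H using Nat.strong_induction_on with
  | _ H ih =>
  intro hH hHM L g hg hg3
  have hs1 : (1:ℝ) ≤ s := by exact_mod_cast hs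
  have hD1 := hD.1
  have hK := K_bound s D hs1 hD1
  have hK4 : 4 ≤ 100 * s * D := by nlinarith
  have hM : A.card ≤ p := by
    refine (card_le_univ A).trans ?_; rw [ZMod.card]
  have hMr : (A.card : ℝ) ≤ p := by exact_mod_cast hM
  have hp1 : (1:ℝ) ≤ p := by exact_mod_cast hp.out.pos
  have hpi1 : 1 ≤ pi := by
    apply le_of_pow_le_pow_left₀ (n := 3) (by norm_num) hpi
    rw [hpi3]; linarith
  have hHp : H ≤ p := by
    have : H^6 ≤ p^6 := hH.trans (Nat.pow_le_pow_right hp.out.pos (by norm_num))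
    exact (Nat.pow_le_pow_iff_left (by norm_num)).mp this
  by_cases h23 : H^3 ≤ p^2
  · obtain ⟨h, hh, hh4⟩ := exists_root 4 (by norm_num) (H:ℝ) (by positivity)
    obtain ⟨Q1, hQ1, hQ16⟩ := exists_root 6 (by norm_num) ((100 * s * D) ^ 6 * p * (A.card:ℝ) ^ 5) (by positivity)
    refine (case_one p s hs A hA D hD Q1 hQ1 hQ16 H h23 L h hh hh4).trans ?_
    apply le_of_pow_le_pow_left₀ (n := 6) (by norm_num) (by positivity)
    have hhp : h^2 ≤ pi := by
      apply le_of_pow_le_pow_left₀ (n := 6) (by norm_num) (by positivity)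
      calc (h^2)^6 = (h^4)^3 := by ring
        _ = (H:ℝ)^3 := by rw [hh4]
        _ ≤ (p:ℝ)^2 := by exact_mod_cast h23
        _ = pi^6 := by rw [← hpi3]; ring
    calc (Q1 * h^3)^6 = Q1^6 * (h^4)^4 * h^2 := by ring
      _ ≤ Q1^6 * (h^4)^4 * pi := by gcongr
      _ = (100 * s * D) ^ 6 * (p * pi) * (A.card:ℝ) ^ 5 * (g^3)^4 := by rw [hQ16, hh4, hg3]; ring
      _ = Q^6 * (g^3)^4 := by rw [hQ6]
      _ = _ := by ring
  push Not at h23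
  by_cases h64 : p < 64
  · refine (SS_trivial p s A L H).trans ?_
    have h4M : 4 * (A.card:ℝ) ≤ Q := by
      apply le_of_pow_le_pow_left₀ (n := 6) (by norm_num) hQ
      rw [hQ6]
      calc (4 * (A.card:ℝ)) ^ 6 = 4^6 * (A.card * 1) * (A.card:ℝ)^5 := by ring
        _ ≤ (100 * s * D)^6 * (p * pi) * (A.card:ℝ)^5 := by gcongr
    have hg4 : g ≤ 4 := by
      apply le_of_pow_le_pow_left₀ (n := 3) (by norm_num) (by norm_num)
      rw [hg3]
      have : (H:ℝ) ≤ 64 := by exact_mod_cast (by omega : H ≤ 64)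
      linarith
    rw [← hg3]
    calc (A.card:ℝ) * g^3 = (A.card * g) * g^2 := by ring
      _ ≤ (A.card * 4) * g^2 := by gcongr
      _ ≤ Q * g^2 := by gcongr; linarith
  · push Not at h64
    set V := ⌊pi⌋₊ with hV
    have hVpi : (V:ℝ) ≤ pi := Nat.floor_le hpi
    have hpiV : pi < V + 1 := Nat.lt_floor_add_one pi
    have hV4 : 4 ≤ V := by
      rw [hV, Nat.le_floor_iff hpi]
      push_cast
      apply le_of_pow_le_pow_left₀ (n := 3) (by norm_num) (by positivity)
      rw [hpi3]
      have : (64:ℝ) ≤ p := by exact_mod_cast h64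
      linarith
    have hV3 : V^3 ≤ p := by
      have : (V:ℝ)^3 ≤ p := by rw [← hpi3]; gcongr
      exact_mod_cast this
    have hV8 : p < 8 * V^3 := by
      have h1 : (p:ℝ) < (V+1)^3 := by rw [← hpi3]; gcongr
      have h2 : p < (V+1)^3 := by exact_mod_cast h1
      have h3 : (V+1)^3 ≤ (2*V)^3 := Nat.pow_le_pow_left (by omega) 3
      have h4 : (2*V)^3 = 8 * V^3 := by ring
      omega
    have hHV : V^2 < H := by
      have : (V^2)^3 < H^3 := by
        calc (V^2)^3 = (V^3)^2 := by ring
          _ ≤ p^2 := Nat.pow_le_pow_left hV3 2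
          _ < H^3 := h23
      exact lt_of_pow_lt_pow_left₀ 3 (by omega) this
    have hH4V : 4 * V ≤ H := by nlinarith
    set U := H / (4 * V) with hU
    have hU1 : 1 ≤ U := (Nat.one_le_div_iff (by omega)).mpr hH4V
    have hUle : 4 * (U * V) ≤ H := by
      have := Nat.div_mul_le_self H (4*V)
      rw [← hU] at this; linarith [this, (by ring : U * (4 * V) = 4 * (U * V))]
    have hUge : H ≤ 8 * (U * V) := by
      have h1 : H < (U + 1) * (4 * V) := by
        have := Nat.lt_div_mul_add (a := H) (b := 4*V) (by omega)
        rw [← hU] at this; linarith [this, (by ring : (U + 1) * (4 * V) = U * (4*V) + 4 * V)]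
      nlinarith
    have hU4 : 4 * U^2 ≤ p := by
      have h1 : (16 * (U^2 * V^2))^3 ≤ p^5 := by
        calc (16 * (U^2 * V^2))^3 = (4 * (U * V))^6 := by ring
          _ ≤ H^6 := Nat.pow_le_pow_left hUle 6
          _ ≤ p^5 := hH
      have h2 : p^2 ≤ (8 * V^3)^2 := Nat.pow_le_pow_left hV8.le 2
      have h3 : (4 * U^2)^3 * p^2 ≤ p^3 * p^2 := by
        calc (4 * U^2)^3 * p^2 ≤ (4 * U^2)^3 * (8 * V^3)^2 := by gcongr
          _ = (16 * (U^2 * V^2))^3 := by ring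
          _ ≤ p^5 := h1
          _ = _ := by ring
      have h4 := Nat.le_of_mul_le_mul_right h3 (by have := hp.out.pos; positivity)
      exact (Nat.pow_le_pow_iff_left (by norm_num)).mp h4
    have hVp : V ≤ p := le_trans (Nat.le_self_pow (by norm_num) V) hV3
    obtain ⟨τ, hτ, hτ3⟩ := exists_root 3 (by norm_num) ((U * V : ℕ):ℝ) (by positivity)
    have hU20 : 0 < U^2 := by positivity
    have hb := step_bound p s hs A hA U V hU1 (by omega) (by omega) hVp D hD L H (by nlinarith)
      (Or.inr hHM) (Or.inr (by omega)) (Q * τ^2) (Q * g^2 / 5) ?_ (by positivity) ?_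
    · refine hb.trans ?_
      have : 2 * τ^2 ≤ 4/5 * g^2 := by
        apply le_of_pow_le_pow_left₀ (n := 3) (by norm_num) (by positivity)
        have h1 : 4 * τ^3 ≤ g^3 := by rw [hτ3, hg3]; exact_mod_cast hUle
        calc (2 * τ^2)^3 = (4 * τ^3)^2 / 2 := by ring
          _ ≤ (g^3)^2 / 2 := by gcongr
          _ ≤ (4/5 * g^2)^3 := by
            have : 0 ≤ g^6 := by positivity
            nlinarith
      nlinarith
    · intro L' t ht
      obtain ⟨θ, hθ, hθ3⟩ := exists_root 3 (by norm_num) (t:ℝ) (by positivity)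
      have htH : t < H := by
        have : 0 < U * V := by positivity
        omega
      refine (ih t htH (le_trans (Nat.pow_le_pow_left htH.le 6) hH) (le_trans (Nat.mul_le_mul_right _ htH.le) hHM) L' θ hθ hθ3).trans ?_
      have : θ ≤ τ := by
        apply le_of_pow_le_pow_left₀ (n := 3) (by norm_num) hτ
        rw [hθ3, hτ3]; exact_mod_cast ht
      gcongr
    · have hU' : g^3 ≤ 8 * (U * pi) := by
        rw [hg3]
        calc (H:ℝ) ≤ 8 * (U * V) := by exact_mod_cast hUge
          _ ≤ _ := by gcongr
      calc 2000000 * s ^ 2 * D * p * (A.card * H : ℝ) ^ 5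
          = (125000 * (2000000 * s ^ 2 * D)) * p * (A.card:ℝ)^5 * g^12 * g^3 / 125000 := by
            rw [← hg3]; ring
        _ ≤ (100 * s * D)^6 * p * (A.card:ℝ)^5 * g^12 * (8 * (U * pi)) / 125000 := by gcongr
        _ = Q^6 * g^12 * (8 * U) / 125000 := by rw [hQ6]; ring
        _ = (Q * g^2 / 5)^6 * U := by ring


theorem subdiv (p s : ℕ) [NeZero p] (A : Finset (ZMod p)) (H1 : ℕ) (B : ℝ) (hB : 0 ≤ B)
    (h : ∀ L : ℤ, ∀ t : ℕ, t ≤ H1 → ‖SS p s A L t‖ ≤ B) :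
    ∀ k : ℕ, ∀ L : ℤ, ∀ H : ℕ, H ≤ k * H1 → ‖SS p s A L H‖ ≤ k * B := by
  intro k
  induction k with
  | zero =>
    intro L H hH
    have : H = 0 := by omega
    subst this
    simp [SS]
  | succ k ih =>
    intro L H hH
    by_cases hc : H ≤ k * H1
    · refine (ih L H hc).trans ?_
      push_cast; linarith
    · push Not at hc
      have e : H = k * H1 + (H - k * H1) := by omega
      rw [e, SS_add]
      refine (norm_add_le _ _).trans ?_
      have h1 := ih L (k * H1) le_rfl
      have h2 := h (L + ((k * H1 : ℕ):ℤ)) (H - k * H1) (by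
        have : (k+1) * H1 = k * H1 + H1 := by ring
        omega)
      push_cast at h2 ⊢
      linarith

theorem subdiv2 (p s : ℕ) [NeZero p] (A : Finset (ZMod p)) (H1 : ℕ) (hH1 : 1 ≤ H1) (B : ℝ) (hB : 0 ≤ B)
    (h : ∀ L : ℤ, ∀ t : ℕ, t ≤ H1 → ‖SS p s A L t‖ ≤ B) (L : ℤ) (H : ℕ) (hH : H1 ≤ H) :
    ‖SS p s A L H‖ ≤ 2 * ((H:ℝ) / H1) * B := by
  have h1 := subdiv p s A H1 B hB h (H / H1 + 1) L H (by
    have := Nat.lt_div_mul_add (a := H) (b := H1) (by omega)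
    nlinarith)
  refine h1.trans ?_
  gcongr
  push_cast
  have h2 : ((H / H1 : ℕ):ℝ) ≤ (H:ℝ) / H1 := Nat.cast_div_le
  have h3 : 1 ≤ (H:ℝ)/H1 := by
    rw [one_le_div (by exact_mod_cast hH1)]; exact_mod_cast hH
  linarith

theorem exp_pow (x : ℝ) (n : ℕ) : (Real.exp x) ^ n = Real.exp (n * x) := (Real.exp_nat_mul x n).symm

theorem case_one' (p s : ℕ) [hp : Fact p.Prime] (hs : 0 < s) (A : Finset (ZMod p)) (hA : ∀ m ∈ A, m ≠ 0)
    (D : ℝ) (hD : DivB p D) (lp lm l : ℝ) (hlp : (p:ℝ) = Real.exp lp) (hlm : (A.card:ℝ) = Real.exp lm)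
    (H : ℕ) (hH : H^3 ≤ p^2) (hl : (H:ℝ) ≤ Real.exp l) (L : ℤ) :
    ‖SS p s A L H‖ ≤ 100 * s * D * Real.exp (lp/6 + 5*lm/6 + 3*l/4) := by
  have hD1 := hD.1
  obtain ⟨h, hh, hh4⟩ := exists_root 4 (by norm_num) (H:ℝ) (by positivity)
  refine (case_one p s hs A hA D hD (100 * s * D * Real.exp (lp/6 + 5*lm/6)) (by positivity) ?_ H hH L h hh hh4).trans ?_
  · rw [mul_pow, exp_pow, hlp, hlm, exp_pow, mul_assoc _ (Real.exp _) (Real.exp _), ← Real.exp_add]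
    congr 2; push_cast; ring
  · have : h ≤ Real.exp (l/4) := by
      apply le_of_pow_le_pow_left₀ (n := 4) (by norm_num) (by positivity)
      rw [hh4, exp_pow]
      have e : ((4:ℕ):ℝ)*(l/4) = l := by push_cast; ring
      rw [e]; exact hl
    calc _ ≤ 100 * s * D * Real.exp (lp/6 + 5*lm/6) * (Real.exp (l/4))^3 := by gcongr
      _ = _ := by
        rw [exp_pow, mul_assoc, ← Real.exp_add]; congr 2; push_cast; ring

theorem case_two' (p s : ℕ) [hp : Fact p.Prime] (hs : 0 < s) (A : Finset (ZMod p)) (hA : ∀ m ∈ A, m ≠ 0)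
    (D : ℝ) (hD : DivB p D) (lp lm l : ℝ) (hlp : (p:ℝ) = Real.exp lp) (hlm : (A.card:ℝ) = Real.exp lm)
    (H : ℕ) (hH : H^6 ≤ p^5) (hHM : H * A.card ≤ p) (hl : (H:ℝ) ≤ Real.exp l) (L : ℤ) :
    ‖SS p s A L H‖ ≤ 100 * s * D * Real.exp (2*lp/9 + 5*lm/6 + 2*l/3) := by
  have hD1 := hD.1
  obtain ⟨h, hh, hh4⟩ := exists_root 3 (by norm_num) (H:ℝ) (by positivity)
  refine (case_two p s hs A hA D hD (100 * s * D * Real.exp (2*lp/9 + 5*lm/6)) (Real.exp (lp/3)) (by positivity)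
    (by positivity) ?_ ?_ H hH hHM L h hh hh4).trans ?_
  · rw [exp_pow, hlp]; congr 1; push_cast; ring
  · rw [mul_pow, exp_pow, hlp, hlm, exp_pow, ← Real.exp_add, mul_assoc _ (Real.exp _) (Real.exp _), ← Real.exp_add]
    congr 2; push_cast; ring
  · have : h ≤ Real.exp (l/3) := by
      apply le_of_pow_le_pow_left₀ (n := 3) (by norm_num) (by positivity)
      rw [hh4, exp_pow]
      have e : ((3:ℕ):ℝ)*(l/3) = l := by push_cast; ring
      rw [e]; exact hl
    calc _ ≤ 100 * s * D * Real.exp (2*lp/9 + 5*lm/6) * (Real.exp (l/3))^2 := by gcongr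
      _ = _ := by
        rw [exp_pow, mul_assoc, ← Real.exp_add]; congr 2; push_cast; ring

theorem floor_exp (x : ℝ) (hx : 0 ≤ x) : 1 ≤ ⌊Real.exp x⌋₊ ∧ Real.exp (x - 1) ≤ (⌊Real.exp x⌋₊ : ℝ) := by
  have h1 : 1 ≤ Real.exp x := Real.one_le_exp hx
  have h2 : 1 ≤ ⌊Real.exp x⌋₊ := by rw [Nat.le_floor_iff (by positivity)]; simpa using h1
  refine ⟨h2, ?_⟩
  have h3 := Nat.lt_floor_add_one (Real.exp x)
  have h4 : (1:ℝ) ≤ ⌊Real.exp x⌋₊ := by exact_mod_cast h2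
  rw [Real.exp_sub]
  rw [div_le_iff₀ (by positivity)]
  have := Real.add_one_le_exp 1
  nlinarith

theorem sup_B (p s : ℕ) [hp : Fact p.Prime] (hs : 0 < s) (A : Finset (ZMod p)) (hA : ∀ m ∈ A, m ≠ 0)
    (D : ℝ) (hD : DivB p D) (lp lm l : ℝ) (hlp : (p:ℝ) = Real.exp lp) (hlm : (A.card:ℝ) = Real.exp lm)
    (hlm0 : 0 ≤ lm) (hlmp : lm ≤ lp)
    (H : ℕ) (hH : p^2 < H^3) (hl : (H:ℝ) = Real.exp l) (L : ℤ) :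
    ‖SS p s A L H‖ ≤ 600 * s * D * (Real.exp (l + lm - lp/18) + Real.exp (2*lp/9 + 5*lm/6 + 2*l/3)) := by
  have hD1 := hD.1
  have hs1 : (1:ℝ) ≤ s := by exact_mod_cast hs
  have hlp0 : 0 ≤ lp := by linarith
  have he : Real.exp 1 ≤ 3 := by linarith [Real.exp_one_lt_d9]
  have hl23 : 2 * lp < 3 * l := by
    have : (p:ℝ)^2 < (H:ℝ)^3 := by exact_mod_cast hH
    rw [hlp, hl, exp_pow, exp_pow, Real.exp_lt_exp] at this
    push_cast at this; linarith
  have hE1 := Real.exp_pos (l + lm - lp/18)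
  have hE2 := Real.exp_pos (2*lp/9 + 5*lm/6 + 2*l/3)
  by_cases hM : lp < 3 * lm
  · obtain ⟨f1, f2⟩ := floor_exp (2*lp/3) (by linarith)
    set H1 := ⌊Real.exp (2*lp/3)⌋₊ with hH1
    have f3 : (H1:ℝ) ≤ Real.exp (2*lp/3) := Nat.floor_le (by positivity)
    have hH1H : H1 ≤ H := by
      have : (H1:ℝ) ≤ H := by
        rw [hl]; refine f3.trans (Real.exp_le_exp.mpr (by linarith))
      exact_mod_cast this
    have hH13 : H1^3 ≤ p^2 := by
      have : (H1:ℝ)^3 ≤ (p:ℝ)^2 := by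
        calc (H1:ℝ)^3 ≤ (Real.exp (2*lp/3))^3 := by gcongr
          _ = (p:ℝ)^2 := by rw [hlp, exp_pow, exp_pow]; congr 1; push_cast; ring
      exact_mod_cast this
    have hb := subdiv2 p s A H1 f1 (100 * s * D * Real.exp (lp/6 + 5*lm/6 + 3*(2*lp/3)/4)) (by positivity) (by
      intro L' t ht
      apply case_one' p s hs A hA D hD lp lm _ hlp hlm t (le_trans (Nat.pow_le_pow_left ht 3) hH13) _ L'
      exact le_trans (by exact_mod_cast ht) f3) L H hH1H
    refine hb.trans ?_
    calc 2 * ((H:ℝ) / H1) * (100 * s * D * Real.exp (lp/6 + 5*lm/6 + 3*(2*lp/3)/4))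
        ≤ 2 * (Real.exp l / Real.exp (2*lp/3-1)) * (100 * s * D * Real.exp (lp/6 + 5*lm/6 + 3*(2*lp/3)/4)) := by
          rw [← hl]; gcongr
      _ = 200 * s * D * Real.exp (l - (2*lp/3-1) + (lp/6 + 5*lm/6 + 3*(2*lp/3)/4)) := by
          rw [← Real.exp_sub, Real.exp_add (l - (2*lp/3-1))]; ring
      _ ≤ 200 * s * D * Real.exp (1 + (l + lm - lp/18)) := by
          gcongr ?_ * ?_
          apply Real.exp_le_exp.mpr; linarith
      _ = 200 * s * D * (Real.exp 1 * Real.exp (l + lm - lp/18)) := by rw [Real.exp_add]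
      _ ≤ 200 * s * D * (3 * Real.exp (l + lm - lp/18)) := by gcongr
      _ = 600 * s * D * (Real.exp (l + lm - lp/18)) := by ring
      _ ≤ _ := by gcongr; linarith
  · push Not at hM
    obtain ⟨f1, f2⟩ := floor_exp (lp - lm) (by linarith)
    obtain ⟨g1, g2⟩ := floor_exp (5*lp/6) (by linarith)
    have f3 : (⌊Real.exp (lp - lm)⌋₊:ℝ) ≤ Real.exp (lp - lm) := Nat.floor_le (by positivity)
    have g3 : (⌊Real.exp (5*lp/6)⌋₊:ℝ) ≤ Real.exp (5*lp/6) := Nat.floor_le (by positivity)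
    set a := ⌊Real.exp (lp - lm)⌋₊
    set b := ⌊Real.exp (5*lp/6)⌋₊
    set H1 := min H (min a b) with hH1
    clear_value H1 a b
    have hH1H : H1 ≤ H := by omega
    have hH1a : H1 ≤ a := by omega
    have hH1b : H1 ≤ b := by omega
    have hH0 : 1 ≤ H := by
      by_contra hc
      have : H = 0 := by omega
      subst this; simp at hH
    have h11 : 1 ≤ H1 := by rw [hH1]; simp only [le_min_iff]; exact ⟨hH0, f1, g1⟩
    have hH10 : (0:ℝ) < H1 := by exact_mod_cast h11
    set l1 := Real.log H1 with hl1
    have hel1 : (H1:ℝ) = Real.exp l1 := (Real.exp_log hH10).symm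
    have hb6 : H1^6 ≤ p^5 := by
      have : (H1:ℝ)^6 ≤ (p:ℝ)^5 := by
        calc (H1:ℝ)^6 ≤ (b:ℝ)^6 := pow_le_pow_left₀ hH10.le (Nat.cast_le.mpr hH1b) 6
          _ ≤ (Real.exp (5*lp/6))^6 := pow_le_pow_left₀ (Nat.cast_nonneg b) g3 6
          _ = (p:ℝ)^5 := by rw [hlp, exp_pow, exp_pow]; congr 1; push_cast; ring
      exact_mod_cast this
    have hHM : H1 * A.card ≤ p := by
      have : (H1:ℝ) * A.card ≤ p := by
        calc (H1:ℝ) * A.card ≤ (a:ℝ) * A.card := mul_le_mul_of_nonneg_right (Nat.cast_le.mpr hH1a) (Nat.cast_nonneg _)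
          _ ≤ Real.exp (lp - lm) * A.card := mul_le_mul_of_nonneg_right f3 (Nat.cast_nonneg _)
          _ = p := by rw [hlp, hlm, ← Real.exp_add]; congr 1; ring
      exact_mod_cast this
    have hb := subdiv2 p s A H1 h11 (100 * s * D * Real.exp (2*lp/9 + 5*lm/6 + 2*l1/3)) (by positivity) (by
      intro L' t ht
      apply case_two' p s hs A hA D hD lp lm _ hlp hlm t (le_trans (Nat.pow_le_pow_left ht 6) hb6) (le_trans (Nat.mul_le_mul_right _ ht) hHM) _ L'
      rw [← hel1]; exact_mod_cast ht) L H hH1H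
    refine hb.trans ?_
    have key : Real.exp (l - l1 + (2*lp/9 + 5*lm/6 + 2*l1/3)) ≤
        3 * (Real.exp (l + lm - lp/18) + Real.exp (2*lp/9 + 5*lm/6 + 2*l/3)) := by
      have k1 : ∀ x, l - l1 + (2*lp/9 + 5*lm/6 + 2*l1/3) ≤ 1 + x →
          Real.exp (l - l1 + (2*lp/9 + 5*lm/6 + 2*l1/3)) ≤ 3 * Real.exp x := by
        intro x hx
        calc _ ≤ Real.exp (1 + x) := Real.exp_le_exp.mpr hx
          _ = Real.exp 1 * Real.exp x := Real.exp_add _ _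
          _ ≤ _ := by gcongr
      have : H1 = H ∨ H1 = a ∨ H1 = b := by omega
      rcases this with h | h | h
      · have : l1 = l := by rw [hl1, h, hl, Real.log_exp]
        have := k1 (2*lp/9 + 5*lm/6 + 2*l/3) (by linarith)
        linarith
      · have : lp - lm - 1 ≤ l1 := by rw [← Real.exp_le_exp, ← hel1, h]; exact f2
        have := k1 (l + lm - lp/18) (by linarith)
        linarith
      · have : 5*lp/6 - 1 ≤ l1 := by rw [← Real.exp_le_exp, ← hel1, h]; exact g2
        have := k1 (l + lm - lp/18) (by linarith)
        linarith
    calc 2 * ((H:ℝ) / H1) * (100 * s * D * Real.exp (2*lp/9 + 5*lm/6 + 2*l1/3))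
        = 200 * s * D * Real.exp (l - l1 + (2*lp/9 + 5*lm/6 + 2*l1/3)) := by
          rw [Real.exp_add (l - l1), Real.exp_sub, hel1, hl]; ring
      _ ≤ 200 * s * D * (3 * (Real.exp (l + lm - lp/18) + Real.exp (2*lp/9 + 5*lm/6 + 2*l/3))) := by gcongr
      _ = _ := by ring


theorem count_abs (p : ℕ) [hp : Fact p.Prime] {α : Type} [DecidableEq α] (B : Fin 6 → Finset α)
    (g : α → ZMod p) (c : ZMod p) :
    |((((Fintype.piFinset B).filter (fun t => ∑ i, g (t i) = c)).card : ℕ) : ℝ)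
      - (∏ i, ((B i).card : ℝ)) / p| ≤
    (1 / p) * ∑ a ∈ (univ : Finset (ZMod p)).erase 0, ∏ i, ‖∑ t ∈ B i, ee p (a * g t)‖ := by
  have hp0 : (0:ℝ) < p := by exact_mod_cast hp.out.pos
  have hpc : (p:ℂ) ≠ 0 := by exact_mod_cast hp.out.ne_zero
  set N := ((Fintype.piFinset B).filter (fun t => ∑ i, g (t i) = c)).card with hN
  have h1 : ∑ a : ZMod p, (∏ i, ∑ t ∈ B i, ee p (a * g t)) * ee p (-(a * c)) = (p:ℂ) * N := by
    have : ∀ a : ZMod p, (∏ i, ∑ t ∈ B i, ee p (a * g t)) * ee p (-(a * c)) =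
        ∑ t ∈ Fintype.piFinset B, ee p (a * (∑ i, g (t i) - c)) := by
      intro a
      rw [Finset.prod_univ_sum, Finset.sum_mul]
      refine Finset.sum_congr rfl fun t _ => ?_
      rw [← ee_sum, ← ee_add]
      congr 1
      rw [← Finset.mul_sum]; ring
    simp_rw [this]
    rw [Finset.sum_comm]
    simp_rw [ee_orth]
    rw [← Finset.sum_filter]
    simp only [sub_eq_zero, Finset.sum_const, nsmul_eq_mul]
    rw [← hN, mul_comm]
  rw [← Finset.add_sum_erase _ _ (Finset.mem_univ (0 : ZMod p))] at h1
  simp only [zero_mul, neg_zero, ee_zero, mul_one, Finset.sum_const, nsmul_eq_mul] at h1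
  have h2 : (((N:ℝ) - (∏ i, ((B i).card : ℝ)) / p : ℝ) : ℂ) =
      (1 / p) * ∑ a ∈ (univ : Finset (ZMod p)).erase 0, (∏ i, ∑ t ∈ B i, ee p (a * g t)) * ee p (-(a * c)) := by
    push_cast
    have : (N:ℂ) = (1/p) * ((p:ℂ) * N) := by field_simp
    rw [this, ← h1]; ring
  rw [← Real.norm_eq_abs, ← Complex.norm_real, h2, norm_mul]
  have e1 : ‖(1 / p : ℂ)‖ = 1 / p := by simp
  rw [e1]
  refine mul_le_mul_of_nonneg_left ?_ (by positivity)
  refine (norm_sum_le _ _).trans (Finset.sum_le_sum fun a _ => ?_)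
  rw [norm_mul, ee_norm, mul_one, norm_prod]

theorem prod_six_bound (n : Fin 6 → ℝ) (hn : ∀ i, 0 ≤ n i) (B : ℝ) (hB : ∀ i, n i ≤ B) :
    ∏ i, n i ≤ B^4 * ((n 4 ^ 2 + n 5 ^ 2) / 2) := by
  have hB0 : 0 ≤ B := (hn 0).trans (hB 0)
  rw [Fin.prod_univ_six]
  have h1 : n 0 * n 1 * n 2 * n 3 ≤ B^4 := by
    calc n 0 * n 1 * n 2 * n 3 ≤ B * B * B * B := by
          have := hn 0
          have := hn 1
          have := hn 2
          have := hn 3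
          gcongr <;> apply hB
      _ = B^4 := by ring
  have h2 : n 4 * n 5 ≤ (n 4 ^ 2 + n 5 ^ 2) / 2 := by nlinarith [sq_nonneg (n 4 - n 5)]
  calc _ = (n 0 * n 1 * n 2 * n 3) * (n 4 * n 5) := by ring
    _ ≤ _ := mul_le_mul h1 h2 (mul_nonneg (hn 4) (hn 5)) (by positivity)

/-- exponents of the fourth power of the sup bound -/
theorem num_terms (X lp lm l w : ℝ) (hX : ∀ y ∈ ({2*lm, 2*lm+2*l-lp, l+lm, l+2*lm-(lm+lp)/4} : Set ℝ),
    X + y ≤ 6*l+6*lm-lp-w) :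
    Real.exp X * (Real.exp (2*lm) + Real.exp (2*lm+2*l-lp) + Real.exp (l+lm) + Real.exp (l+2*lm-(lm+lp)/4))
      ≤ 4 * Real.exp (6*l+6*lm-lp-w) := by
  simp only [Set.mem_insert_iff, Set.mem_singleton_iff, forall_eq_or_imp, forall_eq] at hX
  obtain ⟨h1, h2, h3, h4⟩ := hX
  simp only [mul_add, ← Real.exp_add]
  have h1 := Real.exp_le_exp.mpr h1
  have h2 := Real.exp_le_exp.mpr h2
  have h3 := Real.exp_le_exp.mpr h3
  have h4 := Real.exp_le_exp.mpr h4
  linarith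

theorem num_A (lp lm l w : ℝ) (hw0 : 0 ≤ w) (hw : w ≤ lp/100) (hm : 0 ≤ lm) (hmp : lm ≤ lp)
    (hl : 0 ≤ l) (hlp : l ≤ lp)
    (h1 : 17*lp+17*w ≤ 24*l+11*lm) (h2 : 5*lp+5*w ≤ 9*l+2*lm) (h3 : 5*lp+5*w ≤ 6*l+5*lm)
    (hc : 3*l ≤ 2*lp) :
    Real.exp (2*lp/3+10*lm/3+3*l) * (Real.exp (2*lm) + Real.exp (2*lm+2*l-lp) + Real.exp (l+lm) + Real.exp (l+2*lm-(lm+lp)/4))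
      ≤ 4 * Real.exp (6*l+6*lm-lp-w) := by
  apply num_terms
  simp only [Set.mem_insert_iff, Set.mem_singleton_iff, forall_eq_or_imp, forall_eq]
  refine ⟨?_, ?_, ?_, ?_⟩ <;> linarith

theorem num_B (lp lm l w : ℝ) (hw0 : 0 ≤ w) (hw : w ≤ lp/100) (hm : 0 ≤ lm) (hmp : lm ≤ lp)
    (hl : 0 ≤ l) (hlp : l ≤ lp)
    (h1 : 17*lp+17*w ≤ 24*l+11*lm) (h2 : 5*lp+5*w ≤ 9*l+2*lm) (h3 : 5*lp+5*w ≤ 6*l+5*lm)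
    (hc : 2*lp < 3*l) :
    (Real.exp (4*l+4*lm-2*lp/9) + Real.exp (8*lp/9+10*lm/3+8*l/3)) * (Real.exp (2*lm) + Real.exp (2*lm+2*l-lp) + Real.exp (l+lm) + Real.exp (l+2*lm-(lm+lp)/4))
      ≤ 8 * Real.exp (6*l+6*lm-lp-w) := by
  have e1 := num_terms (4*l+4*lm-2*lp/9) lp lm l w (by
    simp only [Set.mem_insert_iff, Set.mem_singleton_iff, forall_eq_or_imp, forall_eq]
    refine ⟨?_, ?_, ?_, ?_⟩ <;> linarith)
  have e2 := num_terms (8*lp/9+10*lm/3+8*l/3) lp lm l w (by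
    simp only [Set.mem_insert_iff, Set.mem_singleton_iff, forall_eq_or_imp, forall_eq]
    refine ⟨?_, ?_, ?_, ?_⟩ <;> linarith)
  rw [add_mul]; linarith

/-- sup bound, fourth power -/
theorem sup_four (p s : ℕ) [hp : Fact p.Prime] (hs : 0 < s) (D : ℝ) (hD : DivB p D) (lp lm l w : ℝ)
    (hlp : (p:ℝ) = Real.exp lp) (hw0 : 0 ≤ w) (hw : w ≤ lp/100) (hm : 0 ≤ lm) (hmp : lm ≤ lp)
    (hl : 0 ≤ l) (hllp : l ≤ lp)
    (h1 : 17*lp+17*w ≤ 24*l+11*lm) (h2 : 5*lp+5*w ≤ 9*l+2*lm) (h3 : 5*lp+5*w ≤ 6*l+5*lm)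
    (H : ℕ) (hH : (H:ℝ) = Real.exp l) :
    ∃ B : ℝ, 0 ≤ B ∧ (∀ A : Finset (ZMod p), (∀ m ∈ A, m ≠ 0) → (A.card:ℝ) = Real.exp lm → ∀ L : ℤ,
      ‖SS p s A L H‖ ≤ B) ∧
      B^4 * (Real.exp (2*lm) + Real.exp (2*lm+2*l-lp) + Real.exp (l+lm) + Real.exp (l+2*lm-(lm+lp)/4))
        ≤ 64 * (600*s*D)^4 * Real.exp (6*l+6*lm-lp-w) := by
  have hD1 := hD.1
  have hs1 : (1:ℝ) ≤ s := by exact_mod_cast hs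
  obtain ⟨F, hF⟩ : ∃ F, F = Real.exp (2*lm) + Real.exp (2*lm+2*l-lp) + Real.exp (l+lm) + Real.exp (l+2*lm-(lm+lp)/4) := ⟨_, rfl⟩
  have hF0 : 0 ≤ F := by rw [hF]; positivity
  have hG := Real.exp_pos (6*l+6*lm-lp-w)
  by_cases hc : H^3 ≤ p^2
  · have hc' : 3*l ≤ 2*lp := by
      have : (H:ℝ)^3 ≤ (p:ℝ)^2 := by exact_mod_cast hc
      rw [hlp, hH, exp_pow, exp_pow, Real.exp_le_exp] at this
      push_cast at this; linarith
    refine ⟨100 * s * D * Real.exp (lp/6 + 5*lm/6 + 3*l/4), by positivity, fun A hA hlm L =>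
      case_one' p s hs A hA D hD lp lm l hlp hlm H hc hH.le L, ?_⟩
    have := num_A lp lm l w hw0 hw hm hmp hl hllp h1 h2 h3 hc'
    rw [← hF] at this ⊢
    calc _ = (100*s*D)^4 * (Real.exp (2*lp/3+10*lm/3+3*l) * F) := by
          rw [mul_pow, exp_pow, mul_assoc]; congr 3; push_cast; ring
      _ ≤ (100*s*D)^4 * (4 * Real.exp (6*l+6*lm-lp-w)) := by gcongr
      _ ≤ (600*s*D)^4 * (64 * Real.exp (6*l+6*lm-lp-w)) := by gcongr <;> norm_num
      _ = _ := by ring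
  · push Not at hc
    have hc' : 2*lp < 3*l := by
      have : (p:ℝ)^2 < (H:ℝ)^3 := by exact_mod_cast hc
      rw [hlp, hH, exp_pow, exp_pow, Real.exp_lt_exp] at this
      push_cast at this; linarith
    refine ⟨_, ?_, fun A hA hlm L =>
      sup_B p s hs A hA D hD lp lm l hlp hlm hm hmp H hc hH L, ?_⟩
    · positivity
    have := num_B lp lm l w hw0 hw hm hmp hl hllp h1 h2 h3 hc'
    rw [← hF] at this ⊢
    have e8 : ∀ x y : ℝ, (x+y)^4 ≤ 8*(x^4+y^4) := by
      intro x y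
      nlinarith [sq_nonneg (x-y), sq_nonneg (x+y), sq_nonneg (x^2-y^2), sq_nonneg (x*(x-y)), sq_nonneg (y*(x-y)), sq_nonneg ((x-y)*(x-y))]
    have e9 := e8 (Real.exp (l + lm - lp/18)) (Real.exp (2*lp/9 + 5*lm/6 + 2*l/3))
    have e10 : (Real.exp (l + lm - lp/18))^4 = Real.exp (4*l+4*lm-2*lp/9) := by
      rw [exp_pow]; congr 1; push_cast; ring
    have e11 : (Real.exp (2*lp/9 + 5*lm/6 + 2*l/3))^4 = Real.exp (8*lp/9+10*lm/3+8*l/3) := by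
      rw [exp_pow]; congr 1; push_cast; ring
    rw [e10, e11] at e9
    rw [mul_pow]
    calc _ ≤ (600*s*D)^4 * (8 * (Real.exp (4*l+4*lm-2*lp/9) + Real.exp (8*lp/9+10*lm/3+8*l/3))) * F := by gcongr
      _ = 8 * (600*s*D)^4 * ((Real.exp (4*l+4*lm-2*lp/9) + Real.exp (8*lp/9+10*lm/3+8*l/3)) * F) := by ring
      _ ≤ 8 * (600*s*D)^4 * (8 * Real.exp (6*l+6*lm-lp-w)) := by gcongr
      _ = _ := by ring

theorem energy_exp (p s : ℕ) [hp : Fact p.Prime] (hs : 0 < s) (A : Finset (ZMod p))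
    (hA : ∀ m ∈ A, m ≠ 0) (D : ℝ) (hD : DivB p D) (lp lm l : ℝ)
    (hlp : (p:ℝ) = Real.exp lp) (hlm : (A.card:ℝ) = Real.exp lm) (hm : 0 ≤ lm) (hp0 : 0 ≤ lp)
    (L : ℤ) (H : ℕ) (hH1 : 1 ≤ H) (hHp : H < p) (hH : (H:ℝ) = Real.exp l) :
    ((EE p s A (Ico L (L + H))).card : ℝ) ≤
      2000 * s * D^2 * (Real.exp (2*lm) + Real.exp (2*lm+2*l-lp) + Real.exp (l+lm) + Real.exp (l+2*lm-(lm+lp)/4)) := by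
  have := energy_final p s hs A hA D hD (Real.exp ((lm+lp)/4)) (Real.one_le_exp (by linarith)) (by
    rw [exp_pow, hlm, hlp, ← Real.exp_add]; congr 1; push_cast; ring) L H hH1 hHp
  rw [hlp, hlm, hH, exp_pow, exp_pow, ← Real.exp_add, ← Real.exp_add, ← Real.exp_sub, ← Real.exp_sub, ← Real.exp_add] at this
  convert this using 5 <;> (push_cast; ring)


/-- error bound in logarithmic form -/
theorem main_err (p s : ℕ) [hp : Fact p.Prime] (hs : 0 < s) (D : ℝ) (hD : DivB p D) (lp lm l w : ℝ)
    (hlp : (p:ℝ) = Real.exp lp) (hw0 : 0 ≤ w) (hw : w ≤ lp/100) (hm : 0 ≤ lm) (hmp : lm ≤ lp)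
    (hl : 0 ≤ l) (hllp : l ≤ lp)
    (h1 : 17*lp+17*w ≤ 24*l+11*lm) (h2 : 5*lp+5*w ≤ 9*l+2*lm) (h3 : 5*lp+5*w ≤ 6*l+5*lm)
    (H : ℕ) (hH1 : 1 ≤ H) (hHp : H < p) (hH : (H:ℝ) = Real.exp l)
    (𝓜 : Fin 6 → Finset (ZMod p)) (hM : ∀ i, ((𝓜 i).card:ℝ) = Real.exp lm) (hM0 : ∀ i, ∀ m ∈ 𝓜 i, m ≠ 0)
    (L : Fin 6 → ℤ) (hL : ∀ i, ∀ x ∈ Ico (L i) (L i + H), (x : ZMod p) ≠ 0) :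
    (1 / (p:ℝ)) * ∑ a ∈ (univ : Finset (ZMod p)).erase 0, ∏ i,
      ‖∑ t ∈ (𝓜 i) ×ˢ Ico (L i) (L i + H), ee p (a * (t.1 * (((t.2 : ℤ) : ZMod p) ^ s)⁻¹))‖ ≤
    128000 * s * D^2 * (600*s*D)^4 * Real.exp (6*l+6*lm-lp-w) := by
  have hp0 : (0:ℝ) < p := by exact_mod_cast hp.out.pos
  obtain ⟨B, hB0, hB, hB4⟩ := sup_four p s hs D hD lp lm l w hlp hw0 hw hm hmp hl hllp h1 h2 h3 H hH
  have hlp0 : 0 ≤ lp := hm.trans hmp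
  have hE := fun i => energy_exp p s hs (𝓜 i) (hM0 i) D hD lp lm l hlp (hM i) hm hlp0 (L i) H hH1 hHp hH
  have hL2 := fun i => L2_energy p s (𝓜 i) (L i) H (hL i)
  obtain ⟨F, hF⟩ : ∃ F, F = Real.exp (2*lm) + Real.exp (2*lm+2*l-lp) + Real.exp (l+lm) + Real.exp (l+2*lm-(lm+lp)/4) := ⟨_, rfl⟩
  rw [← hF] at hB4
  simp only [← hF] at hE
  obtain ⟨n, hn⟩ : ∃ n : Fin 6 → ZMod p → ℝ, n = fun i a => ‖∑ t ∈ (𝓜 i) ×ˢ Ico (L i) (L i + H), ee p (a * (t.1 * (((t.2 : ℤ) : ZMod p) ^ s)⁻¹))‖ := ⟨_, rfl⟩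
  have hn0 : ∀ i a, 0 ≤ n i a := by intro i a; rw [hn]; exact norm_nonneg _
  have hnB : ∀ a, a ≠ 0 → ∀ i, n i a ≤ B := by
    intro a ha i
    rw [hn]; simp only
    rw [← SS_dilate p s (𝓜 i) a ha (L i) H]
    apply hB
    · intro m hm
      obtain ⟨m', hm', rfl⟩ := Finset.mem_image.mp hm
      exact mul_ne_zero ha (hM0 i m' hm')
    · rw [Finset.card_image_of_injective _ (mul_right_injective₀ ha)]; exact hM i
  have hns : ∀ i, ∑ a, n i a ^ 2 ≤ p * (2000 * s * D^2 * F) := by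
    intro i
    have := hL2 i
    rw [hn]; simp only
    rw [this]
    exact mul_le_mul_of_nonneg_left (hE i) hp0.le
  have hgoal : ∑ a ∈ (univ : Finset (ZMod p)).erase 0, ∏ i, n i a ≤ B^4 * (p * (2000 * s * D^2 * F)) := by
    calc ∑ a ∈ (univ : Finset (ZMod p)).erase 0, ∏ i, n i a
        ≤ ∑ a ∈ (univ : Finset (ZMod p)).erase 0, B^4 * ((n 4 a ^ 2 + n 5 a ^ 2) / 2) :=
          Finset.sum_le_sum fun a ha => prod_six_bound (fun i => n i a) (fun i => hn0 i a) B
            (hnB a (Finset.ne_of_mem_erase ha))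
      _ ≤ ∑ a : ZMod p, B^4 * ((n 4 a ^ 2 + n 5 a ^ 2) / 2) :=
          Finset.sum_le_sum_of_subset_of_nonneg (Finset.erase_subset _ _) (fun a _ _ => by positivity)
      _ = B^4 * ((∑ a, n 4 a ^ 2 + ∑ a, n 5 a ^ 2) / 2) := by
          rw [← Finset.mul_sum, ← Finset.sum_div, Finset.sum_add_distrib]
      _ ≤ _ := by
          refine mul_le_mul_of_nonneg_left ?_ (by positivity)
          linarith [hns 4, hns 5]
  have : (1 / (p:ℝ)) * ∑ a ∈ (univ : Finset (ZMod p)).erase 0, ∏ i, n i a ≤ 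
      128000 * s * D^2 * (600*s*D)^4 * Real.exp (6*l+6*lm-lp-w) := by
    calc _ ≤ (1 / (p:ℝ)) * (B^4 * (p * (2000 * s * D^2 * F))) := mul_le_mul_of_nonneg_left hgoal (by positivity)
      _ = 2000 * s * D^2 * (B^4 * F) := by field_simp
      _ ≤ 2000 * s * D^2 * (64 * (600*s*D)^4 * Real.exp (6*l+6*lm-lp-w)) :=
          mul_le_mul_of_nonneg_left hB4 (by positivity)
      _ = _ := by ring
  rw [hn] at this
  exact this

theorem log_ineq (lp l lm u v e H M p : ℝ) (hH : H = Real.exp l) (hM : M = Real.exp lm) (hp : p = Real.exp lp)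
    (h : p ^ (1+e) < H ^ u * M ^ v) : lp * (1+e) < l * u + lm * v := by
  rw [hH, hM, hp, ← Real.exp_mul, ← Real.exp_mul, ← Real.exp_mul, ← Real.exp_add, Real.exp_lt_exp] at h
  exact h

theorem stmt_2 (s : ℕ) (hs : 0 < s) (ε : ℝ) (hε : 0 < ε) :
    ∃ δ C : ℝ, 0 < δ ∧ 0 < C ∧
      ∀ (p : ℕ), p.Prime → ∀ (H M : ℕ),
      (p : ℝ) ^ ((1:ℝ) + ε) < (H : ℝ) ^ ((24:ℝ)/17) * (M : ℝ) ^ ((11:ℝ)/17) →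
      (p : ℝ) ^ ((1:ℝ) + ε) < (H : ℝ) ^ ((9:ℝ)/5) * (M : ℝ) ^ ((2:ℝ)/5) →
      (p : ℝ) ^ ((1:ℝ) + ε) < (H : ℝ) ^ ((6:ℝ)/5) * (M : ℝ) →
      ∀ (𝓜 : Fin 6 → Finset (ZMod p)), (∀ i, (𝓜 i).card = M) →
      (∀ i, ∀ m ∈ 𝓜 i, m ≠ 0) →
      ∀ (L : Fin 6 → ℤ),
      (∀ i, ∀ x ∈ Finset.Icc (L i + 1) (L i + (H : ℤ)), 1 ≤ x ∧ x ≤ (p : ℤ) - 1) →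
      ∀ lam : ℤ,
      |(((Fintype.piFinset
              (fun i : Fin 6 => (𝓜 i) ×ˢ Finset.Icc (L i + 1) (L i + (H : ℤ)))).filter
            (fun t => ∑ i, (t i).1 * ((((t i).2 : ZMod p)) ^ s)⁻¹ = (lam : ZMod p))).card : ℝ)
          - (H : ℝ) ^ 6 * (M : ℝ) ^ 6 / (p : ℝ)| ≤
        C * ((H : ℝ) ^ 6 * (M : ℝ) ^ 6 / (p : ℝ)) * (p : ℝ) ^ (-δ) := by
  obtain ⟨e, he0, hee, he1⟩ : ∃ e : ℝ, 0 < e ∧ e ≤ ε ∧ e ≤ 1/100 :=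
    ⟨min ε (1/100), by positivity, min_le_left _ _, min_le_right _ _⟩
  obtain ⟨C0, hC0, hDiv⟩ := exists_DivB (e/12) (by positivity)
  have hs1 : (1:ℝ) ≤ s := by exact_mod_cast hs
  refine ⟨e/2, 128000 * s * (600*s)^4 * C0^6, by positivity, by positivity, ?_⟩
  intro p hp H M H1 H2 H3 𝓜 hM hM0 L hL lam
  haveI : Fact p.Prime := ⟨hp⟩
  have hp0 : (0:ℝ) < p := by exact_mod_cast hp.pos
  have hp1 : (1:ℝ) ≤ p := by exact_mod_cast hp.one_lt.le
  have hpp : (0:ℝ) < (p:ℝ)^((1:ℝ)+ε) := Real.rpow_pos_of_pos hp0 _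
  have hH1 : 1 ≤ H := by
    by_contra hc
    have : H = 0 := by omega
    subst this
    rw [Nat.cast_zero, Real.zero_rpow (by norm_num)] at H3
    linarith
  have hM1 : 1 ≤ M := by
    by_contra hc
    have : M = 0 := by omega
    subst this
    rw [Nat.cast_zero] at H3
    linarith
  have hHp : H < p := by
    have a1 := hL 0 (L 0 + 1) (by simp; omega)
    have a2 := hL 0 (L 0 + H) (by simp; omega)
    omega
  have hMp : M ≤ p := by
    rw [← hM 0]
    have := Finset.card_le_univ (𝓜 0)
    rwa [ZMod.card] at this
  have hH0 : (0:ℝ) < H := by exact_mod_cast hH1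
  have hMr0 : (0:ℝ) < M := by exact_mod_cast hM1
  obtain ⟨lp, hlp⟩ : ∃ lp, (p:ℝ) = Real.exp lp := ⟨Real.log p, (Real.exp_log hp0).symm⟩
  obtain ⟨l, hl⟩ : ∃ l, (H:ℝ) = Real.exp l := ⟨Real.log H, (Real.exp_log hH0).symm⟩
  obtain ⟨lm, hlm⟩ : ∃ lm, (M:ℝ) = Real.exp lm := ⟨Real.log M, (Real.exp_log hMr0).symm⟩
  have i1 := log_ineq lp l lm _ _ _ _ _ _ hl hlm hlp H1
  have i2 := log_ineq lp l lm _ _ _ _ _ _ hl hlm hlp H2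
  have i3 := log_ineq lp l lm ((6:ℝ)/5) 1 ε _ _ _ hl hlm hlp (by rw [Real.rpow_one]; exact H3)
  have j1 : 0 ≤ lp := by
    rw [← Real.exp_le_exp, Real.exp_zero, ← hlp]; exact hp1
  have j2 : 0 ≤ l := by
    rw [← Real.exp_le_exp, Real.exp_zero, ← hl]; exact_mod_cast hH1
  have j3 : 0 ≤ lm := by
    rw [← Real.exp_le_exp, Real.exp_zero, ← hlm]; exact_mod_cast hM1
  have j4 : l ≤ lp := by
    rw [← Real.exp_le_exp, ← hlp, ← hl]; exact_mod_cast hHp.le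
  have j5 : lm ≤ lp := by
    rw [← Real.exp_le_exp, ← hlp, ← hlm]; exact_mod_cast hMp
  have j6 : lp * e ≤ lp * ε := mul_le_mul_of_nonneg_left hee j1
  have j7 : lp * e ≤ lp * (1/100) := mul_le_mul_of_nonneg_left he1 j1
  have hIco : ∀ i, Finset.Icc (L i + 1) (L i + (H:ℤ)) = Ico (L i + 1) (L i + 1 + H) := by
    intro i; ext x; simp only [Finset.mem_Icc, Finset.mem_Ico]; omega
  have hz : ∀ i, ∀ x ∈ Ico (L i + 1) (L i + 1 + H), (x : ZMod p) ≠ 0 := by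
    intro i x hx h0
    rw [← hIco] at hx
    obtain ⟨b1, b2⟩ := hL i x hx
    rw [ZMod.intCast_zmod_eq_zero_iff_dvd] at h0
    have := Int.le_of_dvd (by omega) h0
    omega
  simp only [hIco]
  have hcount := count_abs p (fun i => (𝓜 i) ×ˢ Ico (L i + 1) (L i + 1 + (H:ℤ)))
    (fun t : ZMod p × ℤ => t.1 * (((t.2 : ℤ) : ZMod p) ^ s)⁻¹) (lam : ZMod p)
  have herr := main_err p s hs (C0 * (p:ℝ)^(e/12)) (hDiv p hp.one_lt.le) lp lm l (lp*e) hlp (by positivity) (by linarith)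
    j3 j5 j2 j4 (by linarith) (by linarith) (by linarith) H hH1 hHp hl 𝓜
    (fun i => by rw [hM i]; exact hlm) hM0 (fun i => L i + 1) hz
  have hprod : ∏ i : Fin 6, ((((𝓜 i) ×ˢ Ico (L i + 1) (L i + 1 + (H:ℤ))).card : ℕ) : ℝ) = (H:ℝ)^6 * (M:ℝ)^6 := by
    have : ∀ i : Fin 6, ((((𝓜 i) ×ˢ Ico (L i + 1) (L i + 1 + (H:ℤ))).card : ℕ) : ℝ) = M * H := by
      intro i
      rw [Finset.card_product, hM i, Int.card_Ico]
      push_cast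
      congr 2
      simp
    rw [Finset.prod_congr rfl fun i _ => this i]
    simp only [Finset.prod_const, Finset.card_univ, Fintype.card_fin]
    ring
  rw [hprod] at hcount
  refine (hcount.trans herr).trans (le_of_eq ?_)
  have q1 : (p:ℝ)^(e/12) = Real.exp (lp*(e/12)) := by rw [hlp, ← Real.exp_mul]
  have q2 : (p:ℝ)^(-(e/2)) = Real.exp (lp*(-(e/2))) := by rw [hlp, ← Real.exp_mul]
  have q3 : (H:ℝ)^6 * (M:ℝ)^6 / (p:ℝ) * (p:ℝ)^(-(e/2)) = Real.exp (lp*(e/12))^6 * Real.exp (6*l+6*lm-lp-lp*e) := by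
    rw [q2, hlp, hl, hlm, exp_pow, exp_pow, exp_pow, ← Real.exp_add, ← Real.exp_sub, ← Real.exp_add, ← Real.exp_add]
    congr 1; push_cast; ring
  rw [mul_assoc (128000 * s * (600*s)^4 * C0^6 : ℝ), q3, q1]
  ring
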